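/- Fix F_q with q ≡ 1 mod 4. Then as g → ∞, the average class number (1/#H_{2g+1,q}) * sum over D in H_{2g+1,q} of h_D is asymptotic to (q^{g+1/2} · zeta_A(2) · P(2)) · (1 + o(1)), i.e., equals sqrt(|D|)/sqrt(q) · zeta_A(2) · P(2) · (1+o(1)) with |D| = q^{2g+1}. -/

import Mathlib

open Polynomial UniqueFactorizationMonoid
open scoped Classical

/-- The set of monic polynomials of degree `n` over a finite field is finite. -/
theorem monicSet_finite (F : Type) [Field F] [Fintype F] (n : ℕ) :
    {f : Polynomial F | f.Monic ∧ f.natDegree = n}.Finite := by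
  apply Set.Finite.subset (Set.finite_range
    (fun c : Fin n → F => X ^ n + ∑ i : Fin n, C (c i) * X ^ (i : ℕ)))
  rintro f ⟨hm, rfl⟩
  refine ⟨fun i => f.coeff i, ?_⟩
  show X ^ f.natDegree + ∑ i : Fin f.natDegree, C (f.coeff ↑i) * X ^ (i : ℕ) = f
  rw [Fin.sum_univ_eq_sum_range (fun i => C (f.coeff i) * X ^ i) f.natDegree]
  exact (hm.as_sum).symm

/-- `Mn F n` is the (finite) set of monic polynomials of degree `n` in `F[T]`. -/
noncomputable def Mn (F : Type) [Field F] [Fintype F] (n : ℕ) : Finset (Polynomial F) :=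
  (monicSet_finite F n).toFinset

/-- The class number `h_D = |Pic(𝒪_D)|` of `𝒪_D = 𝔽_q[T][√D] = 𝔽_q[T][x]/(x² - D)`, i.e. the
order of the ideal class group of this (Dedekind, for `D` square-free) domain. -/
noncomputable def classNumber {F : Type} [Field F] [Fintype F] (D : Polynomial F) : ℕ :=
  if h : IsDomain (AdjoinRoot ((X : Polynomial (Polynomial F)) ^ 2 - C D)) then
    Nat.card (@ClassGroup (AdjoinRoot ((X : Polynomial (Polynomial F)) ^ 2 - C D)) _ h)
  else 0

section QuadraticOrder

variable {F : Type} [Field F] {D : F[X]}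

theorem natDegree_le_natDegree_norm_form (hD : Odd D.natDegree) (u : F[X]) {v : F[X]}
    (hv : v ≠ 0) : D.natDegree ≤ (u * u - D * v * v).natDegree := by
  have hD0 : D ≠ 0 := by rintro rfl; simp at hD
  have h1 : (D * v * v).natDegree = D.natDegree + 2 * v.natDegree := by
    rw [natDegree_mul (mul_ne_zero hD0 hv) hv, natDegree_mul hD0 hv]; ring
  rcases eq_or_ne u 0 with rfl | hu
  · simp only [mul_zero, zero_sub, natDegree_neg, h1]; omega
  have h2 : (u * u).natDegree = 2 * u.natDegree := by rw [natDegree_mul hu hu]; ring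
  obtain ⟨k, hk⟩ := hD
  rcases lt_or_ge (u * u).natDegree (D * v * v).natDegree with h | h
  · rw [natDegree_sub_eq_right_of_natDegree_lt h]; omega
  · rw [natDegree_sub_eq_left_of_natDegree_lt (by omega)]; omega

theorem norm_form_ne_zero (hD : Odd D.natDegree) (u v : F[X]) (h : u ≠ 0 ∨ v ≠ 0) :
    u * u - D * v * v ≠ 0 := by
  rcases eq_or_ne v 0 with rfl | hv
  · simpa using h
  · intro h0
    have := natDegree_le_natDegree_norm_form hD u hv
    rw [h0, natDegree_zero] at this
    obtain ⟨k, hk⟩ := hD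
    omega

theorem quadraticAlgebra_norm_eq (z : QuadraticAlgebra F[X] D 0) :
    z.norm = z.re * z.re - D * z.im * z.im := by
  simp [QuadraticAlgebra.norm_def]

theorem quadraticAlgebra_norm_ne_zero (hD : Odd D.natDegree) {z : QuadraticAlgebra F[X] D 0}
    (hz : z ≠ 0) : z.norm ≠ 0 := by
  rw [quadraticAlgebra_norm_eq]
  apply norm_form_ne_zero hD
  by_contra! h
  exact hz (QuadraticAlgebra.ext h.1 h.2)

theorem isDomain_quadraticAlgebra (hD : Odd D.natDegree) :
    IsDomain (QuadraticAlgebra F[X] D 0) := by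
  have : NoZeroDivisors (QuadraticAlgebra F[X] D 0) := ⟨fun {z w} h => by
    by_contra! hzw
    refine mul_ne_zero (quadraticAlgebra_norm_ne_zero hD hzw.1)
      (quadraticAlgebra_norm_ne_zero hD hzw.2) ?_
    rw [← map_mul, h, QuadraticAlgebra.norm_zero]⟩
  exact NoZeroDivisors.to_isDomain _

/-- The module `A a + A (b + √D)`, an ideal of `A[√D]` whenever `a ∣ b² - D`. -/
def formIdeal {a b : F[X]} (h : a ∣ b ^ 2 - D) : Ideal (QuadraticAlgebra F[X] D 0) where
  carrier := {z | a ∣ z.re - b * z.im}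
  zero_mem' := by simp
  add_mem' := by
    rintro z w hz hw
    have := dvd_add hz hw
    simp only [Set.mem_ofPred_eq, QuadraticAlgebra.re_add, QuadraticAlgebra.im_add]
    convert this using 1; ring
  smul_mem' := by
    rintro w z hz
    simp only [Set.mem_ofPred_eq, smul_eq_mul, QuadraticAlgebra.re_mul, QuadraticAlgebra.im_mul]
      at hz ⊢
    have := dvd_sub ((hz.mul_left (w.re - b * w.im))) (h.mul_left (w.im * z.im))
    convert this using 1; ring

variable {a b : F[X]}

theorem mem_formIdeal (h : a ∣ b ^ 2 - D) (z : QuadraticAlgebra F[X] D 0) :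
    z ∈ formIdeal h ↔ a ∣ z.re - b * z.im := Iff.rfl

theorem formIdeal_eq_span (h : a ∣ b ^ 2 - D) :
    formIdeal h = Ideal.span {(⟨a, 0⟩ : QuadraticAlgebra F[X] D 0), ⟨b, 1⟩} := by
  apply le_antisymm
  · rintro z ⟨k, hk⟩
    rw [Ideal.mem_span_pair]
    refine ⟨⟨k, 0⟩, ⟨z.im, 0⟩, ?_⟩
    ext : 1
    · simp; linear_combination -hk
    · simp
  · rw [Ideal.span_le]
    rintro z (rfl | rfl) <;> simp [mem_formIdeal]

theorem formIdeal_ne_bot (h : a ∣ b ^ 2 - D) : formIdeal h ≠ ⊥ := by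
  intro h0
  have : (⟨b, 1⟩ : QuadraticAlgebra F[X] D 0) ∈ formIdeal h := by simp [mem_formIdeal]
  rw [h0, Ideal.mem_bot] at this
  simpa using congrArg QuadraticAlgebra.im this

theorem formIdeal_congr {a' b' : F[X]} (h : a ∣ b ^ 2 - D) (h' : a' ∣ b' ^ 2 - D)
    (haa' : Associated a a') (hb : a ∣ b - b') : formIdeal h = formIdeal h' := by
  ext z
  rw [mem_formIdeal, mem_formIdeal, ← haa'.dvd_iff_dvd_left]
  have : z.re - b' * z.im = z.re - b * z.im + (b - b') * z.im := by ring
  rw [this, dvd_add_left (hb.mul_right _)]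

theorem dvd_neg_sq_sub (h : a ∣ b ^ 2 - D) : a ∣ (-b) ^ 2 - D := by rwa [neg_sq]

theorem mem_span_C_iff {e : F[X]} (z : QuadraticAlgebra F[X] D 0) :
    z ∈ Ideal.span {(⟨e, 0⟩ : QuadraticAlgebra F[X] D 0)} ↔ e ∣ z.re ∧ e ∣ z.im := by
  rw [Ideal.mem_span_singleton, ← QuadraticAlgebra.algebraMap_dvd_iff]
  rfl

theorem exists_eq_span_mul_formIdeal (hD : Odd D.natDegree)
    (I : Ideal (QuadraticAlgebra F[X] D 0)) (hI : I ≠ ⊥) :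
    ∃ e a b : F[X], ∃ h : a ∣ b ^ 2 - D, e ≠ 0 ∧ a.Monic ∧
      I = Ideal.span {(⟨e, 0⟩ : QuadraticAlgebra F[X] D 0)} * formIdeal h := by
  have := isDomain_quadraticAlgebra hD
  set E : Ideal F[X] := (I.restrictScalars F[X]).map (QuadraticAlgebra.imₗ D 0) with hE
  set N : Ideal F[X] := I.comap (algebraMap F[X] _) with hN
  have memE : ∀ v, v ∈ E ↔ ∃ z ∈ I, z.im = v := fun v => by
    simp [hE, Submodule.mem_map, QuadraticAlgebra.imₗ]
  obtain ⟨e, he⟩ := (IsPrincipalIdealRing.principal E).principal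
  obtain ⟨n, hn⟩ := (IsPrincipalIdealRing.principal N).principal
  have he' : ∀ v, v ∈ E ↔ e ∣ v := fun v => by rw [he]; exact Ideal.mem_span_singleton
  have hn' : ∀ v, v ∈ N ↔ n ∣ v := fun v => by rw [hn]; exact Ideal.mem_span_singleton
  have memN : ∀ v, v ∈ N ↔ (⟨v, 0⟩ : QuadraticAlgebra F[X] D 0) ∈ I := fun v => Iff.rfl
  have him : ∀ z ∈ I, e ∣ z.im := fun z hz => (he' _).1 ((memE _).2 ⟨z, hz, rfl⟩)
  have hre : ∀ z ∈ I, e ∣ z.re := fun z hz => by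
    have := him _ (I.mul_mem_left ⟨0, 1⟩ hz)
    simpa using this
  obtain ⟨z, hz, hz0⟩ := Submodule.exists_mem_ne_zero_of_ne_bot hI
  have hnI : (⟨n, 0⟩ : QuadraticAlgebra F[X] D 0) ∈ I := (hn' n).2 dvd_rfl
  have hn0 : n ≠ 0 := by
    rintro rfl
    have : z.norm ∈ N := by
      change algebraMap _ _ _ ∈ I
      rw [QuadraticAlgebra.algebraMap_norm_eq_mul_star]
      exact I.mul_mem_right _ hz
    rw [hn', zero_dvd_iff] at this
    exact quadraticAlgebra_norm_ne_zero hD hz0 this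
  obtain ⟨a, rfl⟩ := hre _ hnI
  have he0 : e ≠ 0 := left_ne_zero_of_mul hn0
  have ha0 : a ≠ 0 := right_ne_zero_of_mul hn0
  obtain ⟨w, hw, hwe⟩ := (memE e).1 ((he' e).2 dvd_rfl)
  obtain ⟨b, hb⟩ := hre _ hw
  have hab : a ∣ b ^ 2 - D := by
    have : e * (b ^ 2 - D) ∈ N := by
      rw [memN]
      have := I.mul_mem_left ⟨b, -1⟩ hw
      convert this using 1
      ext : 1
      · simp [hb, hwe]; ring
      · simp [hb, hwe]; ring
    rw [hn'] at this
    exact (mul_dvd_mul_iff_left he0).1 this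
  have key : I = Ideal.span {(⟨e, 0⟩ : QuadraticAlgebra F[X] D 0)} * formIdeal hab := by
    ext y
    rw [Ideal.mem_span_singleton_mul]
    constructor
    · intro hy
      obtain ⟨r, hr⟩ := hre _ hy
      obtain ⟨s, hs⟩ := him _ hy
      refine ⟨⟨r, s⟩, ?_, by ext : 1 <;> simp [hr, hs]⟩
      rw [mem_formIdeal]
      have : e * (r - b * s) ∈ N := by
        rw [memN]
        have := I.sub_mem hy (I.mul_mem_left ⟨s, 0⟩ hw)
        convert this using 1
        ext : 1
        · simp [hb, hr]; ring
        · simp [hwe, hs]; ring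
      rw [hn'] at this
      exact (mul_dvd_mul_iff_left he0).1 this
    · rintro ⟨x, ⟨k, hk⟩, rfl⟩
      have := I.add_mem (I.mul_mem_left ⟨k, 0⟩ hnI) (I.mul_mem_left ⟨x.im, 0⟩ hw)
      convert this using 1
      ext : 1
      · simp [hb]; linear_combination e * hk
      · simp [hwe]; ring
  refine ⟨e, normalize a, b, (normalize_associated a).dvd.trans hab, he0, monic_normalize ha0, ?_⟩
  rw [key]
  congr 1
  exact formIdeal_congr _ _ (normalize_associated a).symm (by simp)

theorem formIdeal_mul_conj (h2 : (2 : F) ≠ 0) (hsf : Squarefree D) (h : a ∣ b ^ 2 - D) :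
    formIdeal h * formIdeal (dvd_neg_sq_sub h) =
      Ideal.span {(⟨a, 0⟩ : QuadraticAlgebra F[X] D 0)} := by
  obtain ⟨c, hc⟩ := id h
  apply le_antisymm
  · rw [Ideal.mul_le]
    rintro z ⟨k, hk⟩ w ⟨l, hl⟩
    rw [mem_span_C_iff]
    have hk' : z.re = b * z.im + a * k := by linear_combination hk
    have hl' : w.re = -b * w.im + a * l := by linear_combination hl
    constructor
    · refine ⟨-c * z.im * w.im + (b * z.im * l - b * w.im * k + a * k * l), ?_⟩
      simp only [QuadraticAlgebra.re_mul, hk', hl']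
      linear_combination (-z.im * w.im) * hc
    · refine ⟨k * w.im + l * z.im, ?_⟩
      simp only [QuadraticAlgebra.im_mul, hk', hl']
      ring
  · rw [Ideal.span_singleton_le_iff_mem]
    obtain ⟨d, hd⟩ := (IsPrincipalIdealRing.principal (Ideal.span {a, b, c})).principal
    have hd' : ∀ v, v ∈ Ideal.span {a, b, c} ↔ d ∣ v := fun v => by
      rw [hd]; exact Ideal.mem_span_singleton
    obtain ⟨a', ha'⟩ := (hd' a).1 (Ideal.subset_span (by simp))
    obtain ⟨b', hb'⟩ := (hd' b).1 (Ideal.subset_span (by simp))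
    obtain ⟨c', hc'⟩ := (hd' c).1 (Ideal.subset_span (by simp))
    have hu : IsUnit d := hsf d ⟨b' ^ 2 - a' * c', by
      rw [ha', hb', hc'] at hc; linear_combination -hc⟩
    have h1 : (1 : F[X]) ∈ Ideal.span {a, b, c} := (hd' 1).2 hu.dvd
    rw [Ideal.mem_span_insert] at h1
    obtain ⟨x, t, ht, hx⟩ := h1
    rw [Ideal.mem_span_pair] at ht
    obtain ⟨y, z, rfl⟩ := ht
    have e1 : (⟨a, 0⟩ : QuadraticAlgebra F[X] D 0) ∈ formIdeal h := by simp [mem_formIdeal]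
    have e2 : (⟨b, 1⟩ : QuadraticAlgebra F[X] D 0) ∈ formIdeal h := by simp [mem_formIdeal]
    have f1 : (⟨a, 0⟩ : QuadraticAlgebra F[X] D 0) ∈ formIdeal (dvd_neg_sq_sub h) := by
      simp [mem_formIdeal]
    have f2 : (⟨-b, 1⟩ : QuadraticAlgebra F[X] D 0) ∈ formIdeal (dvd_neg_sq_sub h) := by
      simp [mem_formIdeal]
    have m1 := Ideal.mul_mem_left _ ⟨x, 0⟩ (Ideal.mul_mem_mul e1 f1)
    have m2 := Ideal.mul_mem_left _ ⟨C (2⁻¹ : F) * y, 0⟩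
      (sub_mem (Ideal.mul_mem_mul e2 f1) (Ideal.mul_mem_mul e1 f2))
    have m3 := Ideal.mul_mem_left _ ⟨-z, 0⟩ (Ideal.mul_mem_mul e2 f2)
    have := add_mem (add_mem m1 m2) m3
    have h22 : C (2⁻¹ : F) * 2 = 1 := by
      rw [show (2 : F[X]) = C 2 from rfl, ← C_mul, inv_mul_cancel₀ h2, C_1]
    convert this using 1
    ext : 1
    · simp
      linear_combination a * hx - z * hc - y * b * a * h22
    · simp

theorem isDedekindDomain_quadraticAlgebra (h2 : (2 : F) ≠ 0) (hsf : Squarefree D)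
    (hD : Odd D.natDegree) : IsDedekindDomain (QuadraticAlgebra F[X] D 0) := by
  have := isDomain_quadraticAlgebra hD
  let K := FractionRing (QuadraticAlgebra F[X] D 0)
  rw [isDedekindDomain_iff_mul_inv_cancel (K := K)]
  have hC : ∀ x : QuadraticAlgebra F[X] D 0, x ≠ 0 → IsUnit
      ((Ideal.span {x} : Ideal _) : FractionalIdeal (nonZeroDivisors (QuadraticAlgebra F[X] D 0)) K) := by
    intro x hx
    rw [FractionalIdeal.coeIdeal_span_singleton]
    have hx' : algebraMap (QuadraticAlgebra F[X] D 0) K x ≠ 0 := by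
      rwa [Ne, FaithfulSMul.algebraMap_eq_zero_iff]
    refine IsUnit.of_mul_eq_one (FractionalIdeal.spanSingleton _ (algebraMap _ K x)⁻¹) ?_
    rw [FractionalIdeal.spanSingleton_mul_spanSingleton, mul_inv_cancel₀ hx',
      FractionalIdeal.spanSingleton_one]
  have hunit : ∀ I : Ideal (QuadraticAlgebra F[X] D 0), I ≠ ⊥ → IsUnit
      (I : FractionalIdeal (nonZeroDivisors (QuadraticAlgebra F[X] D 0)) K) := by
    intro I hI
    obtain ⟨e, a, b, h, he, ha, rfl⟩ := exists_eq_span_mul_formIdeal hD I hI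
    rw [FractionalIdeal.coeIdeal_mul]
    refine (hC _ fun h0 => he (congrArg QuadraticAlgebra.re h0)).mul ?_
    refine isUnit_of_mul_isUnit_left (y := ((formIdeal (dvd_neg_sq_sub h) : Ideal _) :
      FractionalIdeal (nonZeroDivisors (QuadraticAlgebra F[X] D 0)) K)) ?_
    rw [← FractionalIdeal.coeIdeal_mul, formIdeal_mul_conj h2 hsf h]
    exact hC _ fun h0 => ha.ne_zero (congrArg QuadraticAlgebra.re h0)
  intro I hI
  rw [FractionalIdeal.mul_inv_cancel_iff_isUnit]
  obtain ⟨d, J, hd, rfl⟩ := FractionalIdeal.exists_eq_spanSingleton_mul I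
  have hJ : J ≠ ⊥ := by
    rintro rfl
    simp at hI
  refine IsUnit.mul ?_ (hunit J hJ)
  have hx' : algebraMap (QuadraticAlgebra F[X] D 0) K d ≠ 0 := by
    rwa [Ne, FaithfulSMul.algebraMap_eq_zero_iff]
  refine IsUnit.of_mul_eq_one (FractionalIdeal.spanSingleton _ (algebraMap _ K d)) ?_
  rw [FractionalIdeal.spanSingleton_mul_spanSingleton, inv_mul_cancel₀ hx',
    FractionalIdeal.spanSingleton_one]

end QuadraticOrder

section ClassNumber

variable {F : Type} [Field F] {D : F[X]} {a b c : F[X]}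

theorem span_mul_formIdeal_eq (h : a ∣ b ^ 2 - D) (hc : b ^ 2 - D = a * c) :
    Ideal.span {(⟨b, -1⟩ : QuadraticAlgebra F[X] D 0)} * formIdeal h =
      Ideal.span {(⟨a, 0⟩ : QuadraticAlgebra F[X] D 0)} *
        formIdeal (a := c) (b := -b) (D := D) ⟨a, by linear_combination hc⟩ := by
  rw [formIdeal_eq_span, formIdeal_eq_span, Ideal.span_mul_span', Ideal.span_mul_span',
    Set.singleton_mul, Set.singleton_mul, Set.image_pair, Set.image_pair, Set.pair_comm]
  have e1 : (⟨b, -1⟩ : QuadraticAlgebra F[X] D 0) * ⟨b, 1⟩ = ⟨a, 0⟩ * ⟨c, 0⟩ := by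
    ext : 1
    · simp; linear_combination hc
    · simp
  have e2 : (⟨b, -1⟩ : QuadraticAlgebra F[X] D 0) * ⟨a, 0⟩ = -(⟨a, 0⟩ * ⟨-b, 1⟩) := by
    ext : 1
    · simp; ring
    · simp
  rw [e1, e2, Ideal.span_pair_neg]

theorem natDegree_lt_of_reduction {g : ℕ} (hD : D.natDegree = 2 * g + 1)
    (hb : b.degree < a.degree) (ha : g < a.natDegree) (hc : b ^ 2 - D = a * c) :
    c ≠ 0 ∧ c.natDegree < a.natDegree := by
  have hodd : Odd D.natDegree := ⟨g, hD⟩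
  have hne : b ^ 2 - D ≠ 0 := by
    have := norm_form_ne_zero hodd b 1 (Or.inr one_ne_zero)
    convert this using 1; ring
  rw [hc] at hne
  have ha0 := left_ne_zero_of_mul hne
  have hc0 := right_ne_zero_of_mul hne
  refine ⟨hc0, ?_⟩
  have h1 : (b ^ 2 - D).natDegree = a.natDegree + c.natDegree := by
    rw [hc, natDegree_mul ha0 hc0]
  have h2 := natDegree_sub_le (b ^ 2) D
  rw [natDegree_pow] at h2
  have h3 : b.natDegree < a.natDegree := by
    rcases eq_or_ne b 0 with rfl | hb0
    · simp; omega
    · exact natDegree_lt_natDegree hb0 hb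
  omega

theorem map_star_formIdeal (h : a ∣ b ^ 2 - D) :
    (formIdeal h).map (starRingEnd (QuadraticAlgebra F[X] D 0)) =
      formIdeal (dvd_neg_sq_sub h) := by
  rw [formIdeal_eq_span, formIdeal_eq_span, Ideal.map_span, Set.image_pair]
  have e1 : starRingEnd (QuadraticAlgebra F[X] D 0) ⟨a, 0⟩ = ⟨a, 0⟩ := by
    ext : 1 <;> simp [starRingEnd_apply]
  have e2 : starRingEnd (QuadraticAlgebra F[X] D 0) ⟨b, 1⟩ = -⟨-b, 1⟩ := by
    ext : 1 <;> simp [starRingEnd_apply]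
  rw [e1, e2, Ideal.span_pair_neg]

theorem formIdeal_neg_neg (h : a ∣ b ^ 2 - D) :
    formIdeal (dvd_neg_sq_sub (dvd_neg_sq_sub h)) = formIdeal h := by
  ext z; simp [mem_formIdeal]

theorem span_C_eq_iff {x y : F[X]} :
    Ideal.span {(⟨x, 0⟩ : QuadraticAlgebra F[X] D 0)} = Ideal.span {⟨y, 0⟩} ↔
      Associated x y := by
  rw [← dvd_dvd_iff_associated, le_antisymm_iff, Ideal.span_singleton_le_span_singleton,
    Ideal.span_singleton_le_span_singleton, and_comm]
  exact and_congr QuadraticAlgebra.algebraMap_dvd_iff_dvd QuadraticAlgebra.algebraMap_dvd_iff_dvd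

theorem eq_of_span_mul_formIdeal_eq (h2 : (2 : F) ≠ 0) (hsf : Squarefree D) {g : ℕ}
    (hD : D.natDegree = 2 * g + 1) {a' b' : F[X]} (h : a ∣ b ^ 2 - D) (h' : a' ∣ b' ^ 2 - D)
    (ha : a.Monic) (ha' : a'.Monic) (hag : a.natDegree ≤ g) (hag' : a'.natDegree ≤ g)
    (hb : b.degree < a.degree) (hdeg_b : b'.degree < a'.degree)
    {x y : QuadraticAlgebra F[X] D 0} (hx : x ≠ 0)
    (heq : Ideal.span {x} * formIdeal h = Ideal.span {y} * formIdeal h') : a = a' ∧ b = b' := by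
  have := isDomain_quadraticAlgebra (D := D) ⟨g, hD⟩
  set K := formIdeal h * formIdeal (dvd_neg_sq_sub h') with hK
  have hxK : Ideal.span {x} * K = Ideal.span {y * ⟨a', 0⟩} := by
    rw [hK, ← mul_assoc, heq, mul_assoc, formIdeal_mul_conj h2 hsf,
      Ideal.span_singleton_mul_span_singleton]
  obtain ⟨γ, hγK, hγ⟩ : ∃ γ ∈ K, x * γ = y * ⟨a', 0⟩ := by
    rw [← Ideal.mem_span_singleton_mul, hxK]
    exact Ideal.mem_span_singleton_self _
  have hKγ : K = Ideal.span {γ} := by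
    rw [← hγ, ← Ideal.span_singleton_mul_span_singleton] at hxK
    exact (Ideal.span_singleton_mul_right_inj hx).1 hxK
  have hconj : K.map (starRingEnd _) = Ideal.span {star γ} := by
    rw [hKγ, Ideal.map_span, Set.image_singleton, starRingEnd_apply]
  rw [hK, Ideal.map_mul, map_star_formIdeal, map_star_formIdeal, formIdeal_neg_neg h'] at hconj
  have hnorm : Ideal.span {(⟨γ.norm, 0⟩ : QuadraticAlgebra F[X] D 0)} =
      Ideal.span {⟨a * a', 0⟩} := by
    have e1 : (⟨γ.norm, 0⟩ : QuadraticAlgebra F[X] D 0) = γ * star γ :=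
      QuadraticAlgebra.algebraMap_norm_eq_mul_star γ
    have e2 : (⟨a * a', 0⟩ : QuadraticAlgebra F[X] D 0) = ⟨a, 0⟩ * ⟨a', 0⟩ := by
      ext : 1 <;> simp
    rw [e1, e2, ← Ideal.span_singleton_mul_span_singleton,
      ← Ideal.span_singleton_mul_span_singleton, ← hKγ, ← hconj, hK, ← formIdeal_mul_conj h2 hsf h,
      ← formIdeal_mul_conj h2 hsf h']
    ring
  rw [span_C_eq_iff, quadraticAlgebra_norm_eq] at hnorm
  have him : γ.im = 0 := by
    by_contra hne
    have h3 := natDegree_le_natDegree_norm_form (D := D) ⟨g, hD⟩ γ.re hne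
    rw [natDegree_eq_of_degree_eq (degree_eq_degree_of_associated hnorm),
      natDegree_mul ha.ne_zero ha'.ne_zero] at h3
    omega
  rw [him] at hnorm
  simp only [mul_zero, sub_zero] at hnorm
  have hγ' : γ = ⟨γ.re, 0⟩ := by ext : 1 <;> simp [him]
  have hdiv : ∀ z ∈ K, γ.re ∣ z.im := fun z hz => by
    rw [hKγ, hγ', mem_span_C_iff] at hz
    exact hz.2
  have e1 : (⟨a, 0⟩ : QuadraticAlgebra F[X] D 0) ∈ formIdeal h := by simp [mem_formIdeal]
  have e2 : (⟨b, 1⟩ : QuadraticAlgebra F[X] D 0) ∈ formIdeal h := by simp [mem_formIdeal]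
  have f1 : (⟨a', 0⟩ : QuadraticAlgebra F[X] D 0) ∈ formIdeal (dvd_neg_sq_sub h') := by
    simp [mem_formIdeal]
  have f2 : (⟨-b', 1⟩ : QuadraticAlgebra F[X] D 0) ∈ formIdeal (dvd_neg_sq_sub h') := by
    simp [mem_formIdeal]
  have d1 : γ.re ∣ a := by simpa using hdiv _ (Ideal.mul_mem_mul e1 f2)
  have d2 : γ.re ∣ a' := by simpa using hdiv _ (Ideal.mul_mem_mul e2 f1)
  have d3 : γ.re ∣ b - b' := by
    simpa [sub_eq_add_neg] using hdiv _ (Ideal.mul_mem_mul e2 f2)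
  have hdeg : 2 * γ.re.natDegree = a.natDegree + a'.natDegree := by
    have := natDegree_eq_of_degree_eq (degree_eq_degree_of_associated hnorm)
    rw [natDegree_mul ha.ne_zero ha'.ne_zero, ← pow_two, natDegree_pow] at this
    exact this
  have l1 := natDegree_le_of_dvd d1 ha.ne_zero
  have l2 := natDegree_le_of_dvd d2 ha'.ne_zero
  have a1 : Associated γ.re a := associated_of_dvd_of_natDegree_le d1 ha.ne_zero (by omega)
  have a2 : Associated γ.re a' := associated_of_dvd_of_natDegree_le d2 ha'.ne_zero (by omega)
  have haa : a = a' := eq_of_monic_of_associated ha ha' (a1.symm.trans a2)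
  refine ⟨haa, ?_⟩
  subst haa
  rw [← sub_eq_zero]
  refine eq_zero_of_dvd_of_degree_lt (a1.symm.dvd.trans d3) ?_
  exact (degree_sub_le _ _).trans_lt (max_lt hb hdeg_b)

/-- The reduced pairs `(a, b)` (Mumford representations) attached to `D`. -/
def reducedPairs (D : F[X]) (g : ℕ) : Set (F[X] × F[X]) :=
  {p | p.1.Monic ∧ p.1.natDegree ≤ g ∧ p.2.degree < p.1.degree ∧ p.1 ∣ p.2 ^ 2 - D}

theorem exists_reduced [IsDedekindDomain (QuadraticAlgebra F[X] D 0)] {g : ℕ}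
    (hD : D.natDegree = 2 * g + 1) (n : ℕ) : ∀ (a b : F[X]) (h : a ∣ b ^ 2 - D),
    a.natDegree = n → a ≠ 0 →
    ∃ (a' b' : F[X]) (h' : a' ∣ b' ^ 2 - D), (a', b') ∈ reducedPairs D g ∧
      ClassGroup.mk0 ⟨formIdeal h, mem_nonZeroDivisors_of_ne_zero (formIdeal_ne_bot h)⟩ =
      ClassGroup.mk0 ⟨formIdeal h', mem_nonZeroDivisors_of_ne_zero (formIdeal_ne_bot h')⟩ := by
  induction n using Nat.strong_induction_on with
  | _ n ih =>
  intro a b h hn ha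
  set A := normalize a with hA
  have hassoc : Associated a A := (normalize_associated a).symm
  have hAm : A.Monic := monic_normalize ha
  have hdeg : A.natDegree = n := by
    rw [← hn]; exact natDegree_eq_of_degree_eq (degree_eq_degree_of_associated hassoc.symm)
  set B := b %ₘ A with hB
  have hBd : B.degree < A.degree := degree_modByMonic_lt _ hAm
  have hbB : A ∣ b - B := by
    refine ⟨b /ₘ A, ?_⟩
    have := modByMonic_add_div b A
    linear_combination -this
  have hAB : A ∣ B ^ 2 - D := by
    have h1 : A ∣ b ^ 2 - D := hassoc.dvd_iff_dvd_left.1 h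
    have h2 := dvd_sub h1 (hbB.mul_left (b + B))
    convert h2 using 1; ring
  have heq : formIdeal h = formIdeal hAB :=
    formIdeal_congr _ _ hassoc (hassoc.dvd_iff_dvd_left.2 hbB)
  simp only [heq]
  by_cases hg : A.natDegree ≤ g
  · exact ⟨A, B, hAB, ⟨hAm, hg, hBd, hAB⟩, rfl⟩
  · obtain ⟨c, hc⟩ := id hAB
    obtain ⟨hc0, hcd⟩ := natDegree_lt_of_reduction hD hBd (by omega) hc
    obtain ⟨a', b', h', hr, hcl⟩ := ih c.natDegree (by omega) c (-B)
      ⟨A, by linear_combination hc⟩ rfl hc0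
    refine ⟨a', b', h', hr, ?_⟩
    rw [← hcl, ClassGroup.mk0_eq_mk0_iff]
    refine ⟨⟨B, -1⟩, ⟨A, 0⟩, ?_, ?_, span_mul_formIdeal_eq hAB hc⟩
    · intro h0; simpa using congrArg QuadraticAlgebra.im h0
    · intro h0; exact hAm.ne_zero (congrArg QuadraticAlgebra.re h0)

theorem card_classGroup_quadraticAlgebra (h2 : (2 : F) ≠ 0) (hsf : Squarefree D) {g : ℕ}
    (hD : D.natDegree = 2 * g + 1) [IsDomain (QuadraticAlgebra F[X] D 0)] :
    Nat.card (ClassGroup (QuadraticAlgebra F[X] D 0)) = Nat.card (reducedPairs D g) := by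
  have := isDedekindDomain_quadraticAlgebra h2 hsf ⟨g, hD⟩
  symm
  refine Nat.card_eq_of_bijective (fun p : reducedPairs D g => ClassGroup.mk0
    ⟨formIdeal p.2.2.2.2, mem_nonZeroDivisors_of_ne_zero (formIdeal_ne_bot _)⟩) ⟨?_, ?_⟩
  · rintro ⟨⟨a, b⟩, ha, hag, hb, h⟩ ⟨⟨a', b'⟩, ha', hag', hb', h'⟩ heq
    simp only [ClassGroup.mk0_eq_mk0_iff] at heq
    obtain ⟨x, y, hx, -, hxy⟩ := heq
    obtain ⟨rfl, rfl⟩ := eq_of_span_mul_formIdeal_eq h2 hsf hD h h' ha ha' hag hag' hb hb' hx hxy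
    rfl
  · intro cl
    obtain ⟨⟨I, hI⟩, rfl⟩ := ClassGroup.mk0_surjective cl
    obtain ⟨e, a, b, h, he, ha, hIe⟩ := exists_eq_span_mul_formIdeal (D := D) ⟨g, hD⟩ I
      (nonZeroDivisors.ne_zero hI)
    obtain ⟨a', b', h', hr, hcl⟩ := exists_reduced hD _ a b h rfl ha.ne_zero
    refine ⟨⟨(a', b'), hr⟩, ?_⟩
    change ClassGroup.mk0 ⟨formIdeal h', _⟩ = _
    rw [← hcl, ClassGroup.mk0_eq_mk0_iff]
    refine ⟨⟨e, 0⟩, 1, fun h0 => he (congrArg QuadraticAlgebra.re h0), one_ne_zero, ?_⟩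
    simp [hIe]

/-- The identification of `A[x]/(x² - D)` with the quadratic algebra. -/
noncomputable def adjoinRootEquivQuadraticAlgebra (D : F[X]) :
    AdjoinRoot ((X : Polynomial F[X]) ^ 2 - C D) ≃+* QuadraticAlgebra F[X] D 0 :=
  RingEquiv.ofRingHom
    (AdjoinRoot.lift (algebraMap F[X] (QuadraticAlgebra F[X] D 0)) ⟨0, 1⟩ (by
      simp only [eval₂_sub, eval₂_C, pow_two]
      ext : 1 <;> simp))
    ((QuadraticAlgebra.lift (a := D) (b := 0) ⟨AdjoinRoot.root _, by
      have := AdjoinRoot.eval₂_root ((X : Polynomial F[X]) ^ 2 - C D)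
      simp only [eval₂_sub, eval₂_pow, eval₂_X, eval₂_C] at this
      simp only [Algebra.smul_def, mul_one, AdjoinRoot.algebraMap_eq, map_zero, zero_mul,
        add_zero]
      linear_combination this⟩ : QuadraticAlgebra F[X] D 0 →ₐ[F[X]]
        AdjoinRoot ((X : Polynomial F[X]) ^ 2 - C D)) : QuadraticAlgebra F[X] D 0 →+* _)
    (by
      ext z : 1
      simp only [QuadraticAlgebra.lift]
      ext : 1 <;> simp [Algebra.smul_def])
    (by
      apply AdjoinRoot.ringHom_ext
      · refine RingHom.ext fun p => ?_
        simp [QuadraticAlgebra.lift, Algebra.smul_def, AdjoinRoot.algebraMap_eq]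
      · simp [QuadraticAlgebra.lift])

theorem classNumber_eq_card_reducedPairs [Fintype F] (h2 : (2 : F) ≠ 0) (hsf : Squarefree D)
    {g : ℕ} (hD : D.natDegree = 2 * g + 1) :
    classNumber D = Nat.card (reducedPairs D g) := by
  have := isDomain_quadraticAlgebra (D := D) ⟨g, hD⟩
  have hdom : IsDomain (AdjoinRoot ((X : Polynomial F[X]) ^ 2 - C D)) :=
    (adjoinRootEquivQuadraticAlgebra D).toMulEquiv.isDomain _
  rw [classNumber, dif_pos hdom, ← card_classGroup_quadraticAlgebra h2 hsf hD]
  exact Nat.card_congr (ClassGroup.mulEquiv (adjoinRootEquivQuadraticAlgebra D)).toEquiv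

end ClassNumber

section Counting

variable {F : Type} [Field F] [Fintype F]

theorem mem_Mn {n : ℕ} {f : F[X]} : f ∈ Mn F n ↔ f.Monic ∧ f.natDegree = n := by
  simp [Mn]

variable (F) in
/-- The finite set of polynomials of degree less than `n`. -/
noncomputable def polysLT (n : ℕ) : Finset F[X] :=
  Finset.univ.image fun c : Fin n → F => (((degreeLTEquiv F n).symm c : degreeLT F n) : F[X])

theorem mem_polysLT {n : ℕ} {f : F[X]} : f ∈ polysLT F n ↔ f.degree < n := by
  simp only [polysLT, Finset.mem_image, Finset.mem_univ, true_and]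
  constructor
  · rintro ⟨c, rfl⟩
    exact mem_degreeLT.1 ((degreeLTEquiv F n).symm c).2
  · intro h
    exact ⟨degreeLTEquiv F n ⟨f, mem_degreeLT.2 h⟩, by simp⟩

theorem card_polysLT (n : ℕ) : (polysLT F n).card = Fintype.card F ^ n := by
  rw [polysLT, Finset.card_image_of_injective]
  · simp
  · exact Subtype.coe_injective.comp (degreeLTEquiv F n).symm.injective

theorem Mn_eq_image (n : ℕ) : Mn F n = (polysLT F n).image (X ^ n + ·) := by
  ext f
  simp only [mem_Mn, Finset.mem_image, mem_polysLT]
  constructor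
  · rintro ⟨hf, rfl⟩
    refine ⟨f - X ^ f.natDegree, ?_, by ring⟩
    rw [← degree_eq_natDegree hf.ne_zero]
    refine degree_sub_lt_left ?_ hf.ne_zero ?_
    · rw [degree_X_pow, degree_eq_natDegree hf.ne_zero]
    · rw [hf.leadingCoeff, leadingCoeff_X_pow]
  · rintro ⟨b, hb, rfl⟩
    refine ⟨monic_X_pow_add hb, natDegree_eq_of_degree_eq_some ?_⟩
    rw [degree_add_eq_left_of_degree_lt (by rwa [degree_X_pow]), degree_X_pow]

theorem card_Mn (n : ℕ) : (Mn F n).card = Fintype.card F ^ n := by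
  rw [Mn_eq_image, Finset.card_image_of_injective _ (add_right_injective _), card_polysLT]

theorem card_polysLT_filter_le {Q : F[X]} (hQ : Q.Monic) (n : ℕ) (r : F[X]) :
    ((polysLT F n).filter (fun b => Q ∣ b - r)).card ≤
      Fintype.card F ^ (n - Q.natDegree) := by
  rw [← card_polysLT]
  refine Finset.card_le_card_of_injOn (fun b => b /ₘ Q) ?_ ?_
  · intro b hb
    simp only [Finset.coe_filter, mem_polysLT, Set.mem_ofPred_eq] at hb
    simp only [SetLike.mem_coe, mem_polysLT]
    by_cases h : b /ₘ Q = 0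
    · simp [h]
    · rw [degree_eq_natDegree h, natDegree_divByMonic _ hQ]
      have hb0 : b ≠ 0 := by rintro rfl; simp at h
      have h1 := hb.1
      rw [degree_eq_natDegree hb0] at h1
      have h2 : ¬ b.degree < Q.degree := fun h3 => h ((divByMonic_eq_zero_iff hQ).2 h3)
      rw [degree_eq_natDegree hb0, degree_eq_natDegree hQ.ne_zero] at h2
      norm_cast at h1 h2 ⊢
      omega
  · intro b hb b' hb' h
    simp only [Finset.coe_filter, mem_polysLT, Set.mem_ofPred_eq] at hb hb'
    have h3 : b %ₘ Q = b' %ₘ Q := by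
      rw [← sub_eq_zero, ← sub_modByMonic, modByMonic_eq_zero_iff_dvd hQ]
      convert dvd_sub hb.2 hb'.2 using 1
      ring
    rw [← modByMonic_add_div b Q, ← modByMonic_add_div b' Q, h3]
    simp only at h
    rw [h]

theorem card_polysLT_filter {Q : F[X]} (hQ : Q.Monic) {n : ℕ} (hn : Q.natDegree ≤ n) (r : F[X]) :
    ((polysLT F n).filter (fun b => Q ∣ b - r)).card = Fintype.card F ^ (n - Q.natDegree) := by
  refine le_antisymm (card_polysLT_filter_le hQ n r) ?_
  rw [← card_polysLT]
  refine Finset.card_le_card_of_injOn (fun e => r %ₘ Q + Q * e) ?_ ?_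
  · intro e he
    simp only [SetLike.mem_coe, mem_polysLT] at he
    simp only [Finset.coe_filter, mem_polysLT, Set.mem_ofPred_eq]
    constructor
    · refine (degree_add_le _ _).trans_lt (max_lt ?_ ?_)
      · refine (degree_modByMonic_lt _ hQ).trans_le ?_
        rw [degree_eq_natDegree hQ.ne_zero]
        exact_mod_cast hn
      · by_cases h : e = 0
        · simp [h]
        · rw [degree_mul, degree_eq_natDegree hQ.ne_zero, degree_eq_natDegree h]
          rw [degree_eq_natDegree h] at he
          norm_cast at he ⊢
          omega
    · have := modByMonic_add_div r Q
      refine ⟨e - r /ₘ Q, ?_⟩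
      linear_combination this
  · intro e _ e' _ h
    exact mul_left_cancel₀ hQ.ne_zero (add_left_cancel h)

theorem card_Mn_filter_eq (Q : F[X]) (n : ℕ) (r : F[X]) :
    ((Mn F n).filter (fun c => Q ∣ c - r)).card =
      ((polysLT F n).filter (fun b => Q ∣ b - (r - X ^ n))).card := by
  rw [Mn_eq_image, Finset.filter_image,
    Finset.card_image_of_injective _ (add_right_injective _)]
  congr 1
  refine Finset.filter_congr fun b _ => ?_
  rw [show X ^ n + b - r = b - (r - X ^ n) by ring]

theorem card_Mn_filter_le {Q : F[X]} (hQ : Q.Monic) (n : ℕ) (r : F[X]) :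
    ((Mn F n).filter (fun c => Q ∣ c - r)).card ≤ Fintype.card F ^ (n - Q.natDegree) := by
  rw [card_Mn_filter_eq]
  exact card_polysLT_filter_le hQ n _

theorem card_Mn_filter {Q : F[X]} (hQ : Q.Monic) {n : ℕ} (hn : Q.natDegree ≤ n) (r : F[X]) :
    ((Mn F n).filter (fun c => Q ∣ c - r)).card = Fintype.card F ^ (n - Q.natDegree) := by
  rw [card_Mn_filter_eq]
  exact card_polysLT_filter hQ hn _

/-- The number of zeros of `y² + xz` over a finite local ring whose maximal ideal has square
zero. -/
theorem card_quadric_zeros {R K : Type*} [CommRing R] [Fintype R] [Field K] [Fintype K]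
    (ψ : R →+* K) (hψ : Function.Surjective ψ) (hu : ∀ x, ψ x ≠ 0 → IsUnit x)
    (hz : ∀ x y, ψ x = 0 → ψ y = 0 → x * y = 0) (hR : Fintype.card R = Fintype.card K ^ 2) :
    (Finset.univ.filter (fun t : R × R × R => t.2.1 ^ 2 + t.1 * t.2.2 = 0)).card +
      Fintype.card K ^ 2 = Fintype.card K ^ 4 + Fintype.card K ^ 3 := by
  set s := Fintype.card K with hs
  have hspos : 0 < s := Fintype.card_pos
  have hI : (Finset.univ.filter (fun x : R => ψ x = 0)).card = s := by
    have h1 : ∀ k : K, (Finset.univ.filter (fun x : R => ψ x = k)).card =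
        (Finset.univ.filter (fun x : R => ψ x = 0)).card := by
      intro k
      obtain ⟨x₀, rfl⟩ := hψ k
      refine Finset.card_bij' (fun x _ => x - x₀) (fun x _ => x + x₀) ?_ ?_ ?_ ?_ <;>
        simp +contextual
    have h2 := Finset.card_eq_sum_card_fiberwise (f := ψ) (s := Finset.univ) (t := Finset.univ)
      (fun _ _ => Finset.mem_coe.2 (Finset.mem_univ _))
    rw [Finset.sum_congr rfl (fun k _ => h1 k)] at h2
    simp only [Finset.card_univ, Finset.sum_const, smul_eq_mul, hR, ← hs] at h2
    rw [pow_two] at h2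
    exact (Nat.eq_of_mul_eq_mul_left hspos h2).symm
  have hsq : ∀ y : R, ψ (y ^ 2) = 0 ↔ ψ y = 0 := by simp
  have key : (Finset.univ.filter (fun t : R × R × R => t.2.1 ^ 2 + t.1 * t.2.2 = 0)).card =
      ∑ x : R, (Finset.univ.filter (fun t : R × R => t.1 ^ 2 + x * t.2 = 0)).card := by
    simp only [Finset.card_filter]
    rw [Fintype.sum_prod_type]
  have c1 : ∀ x : R, ψ x ≠ 0 →
      (Finset.univ.filter (fun t : R × R => t.1 ^ 2 + x * t.2 = 0)).card = s ^ 2 := by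
    intro x hx
    obtain ⟨u, rfl⟩ := hu x hx
    rw [← hR, ← Finset.card_univ]
    refine Finset.card_bij' (fun t _ => t.1) (fun y _ => (y, -(↑u⁻¹ * y ^ 2))) ?_ ?_ ?_ ?_
    · simp
    · simp
    · rintro ⟨y, z⟩ h
      simp only [Finset.mem_filter, Finset.mem_univ, true_and] at h
      simp only [Prod.mk.injEq, true_and]
      have : (↑u⁻¹ : R) * (y ^ 2 + u * z) = 0 := by rw [h, mul_zero]
      rw [mul_add, Units.inv_mul_cancel_left] at this
      linear_combination -this
    · simp
  have c2 : ∀ x : R, ψ x = 0 → x ≠ 0 →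
      (Finset.univ.filter (fun t : R × R => t.1 ^ 2 + x * t.2 = 0)).card = s ^ 2 := by
    intro x hx hx0
    have : (Finset.univ.filter (fun t : R × R => t.1 ^ 2 + x * t.2 = 0)) =
        (Finset.univ.filter (fun x : R => ψ x = 0)) ×ˢ
          (Finset.univ.filter (fun x : R => ψ x = 0)) := by
      ext ⟨y, z⟩
      simp only [Finset.mem_filter, Finset.mem_univ, true_and, Finset.mem_product]
      constructor
      · intro h
        have hy : ψ y = 0 := by
          have := congrArg ψ h
          simpa [hx] using this
        refine ⟨hy, ?_⟩
        by_contra hz'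
        rw [pow_two, hz y y hy hy, zero_add] at h
        exact hx0 (((hu z hz').mul_left_eq_zero).1 h)
      · rintro ⟨hy, hz'⟩
        rw [pow_two, hz y y hy hy, hz x z hx hz', add_zero]
    rw [this, Finset.card_product, hI, pow_two]
  have c3 : (Finset.univ.filter (fun t : R × R => t.1 ^ 2 + 0 * t.2 = 0)).card = s ^ 3 := by
    have : (Finset.univ.filter (fun t : R × R => t.1 ^ 2 + 0 * t.2 = 0)) =
        (Finset.univ.filter (fun x : R => ψ x = 0)) ×ˢ Finset.univ := by
      ext ⟨y, z⟩
      simp only [Finset.mem_filter, Finset.mem_univ, true_and, Finset.mem_product, zero_mul,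
        add_zero, and_true]
      constructor
      · intro h
        rw [← hsq, h, map_zero]
      · intro hy
        rw [pow_two, hz y y hy hy]
    rw [this, Finset.card_product, hI, Finset.card_univ, hR]
    ring
  have c4 : ∀ x ∈ (Finset.univ : Finset R).erase 0,
      (Finset.univ.filter (fun t : R × R => t.1 ^ 2 + x * t.2 = 0)).card = s ^ 2 := by
    intro x hx
    by_cases h : ψ x = 0
    · exact c2 x h (Finset.ne_of_mem_erase hx)
    · exact c1 x h
  rw [key, ← Finset.add_sum_erase _ _ (Finset.mem_univ (0 : R)), c3, Finset.sum_congr rfl c4]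
  simp only [Finset.sum_const, smul_eq_mul, Finset.card_erase_of_mem (Finset.mem_univ (0 : R)),
    Finset.card_univ, hR]
  have : 1 ≤ s ^ 2 := Nat.one_le_pow _ _ hspos
  obtain ⟨k, hk⟩ := Nat.exists_eq_add_of_le this
  rw [hk, Nat.add_sub_cancel_left, show s ^ 4 = (s ^ 2) ^ 2 by ring, hk]
  ring

end Counting

section Densities

theorem mk_eq_mk_iff_dvd {F : Type} [Field F] (Q x y : F[X]) :
    Ideal.Quotient.mk (Ideal.span {Q}) x = Ideal.Quotient.mk (Ideal.span {Q}) y ↔ Q ∣ x - y := by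
  rw [Ideal.Quotient.eq, Ideal.mem_span_singleton]

variable {F : Type} [Field F] [Fintype F]

section Fibres

variable {R : Type*} [CommRing R] {φ : F[X] →+* R} {Q : F[X]}

theorem card_Mn_fibre (hφ : Function.Surjective φ) (hk : ∀ x y, φ x = φ y ↔ Q ∣ x - y)
    (hQ : Q.Monic) {n : ℕ} (hn : Q.natDegree ≤ n) (x : R) :
    ((Mn F n).filter (fun c => φ c = x)).card = Fintype.card F ^ (n - Q.natDegree) := by
  obtain ⟨r, rfl⟩ := hφ x
  simp only [hk]
  exact card_Mn_filter hQ hn r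

theorem card_polysLT_fibre (hφ : Function.Surjective φ) (hk : ∀ x y, φ x = φ y ↔ Q ∣ x - y)
    (hQ : Q.Monic) {n : ℕ} (hn : Q.natDegree ≤ n) (x : R) :
    ((polysLT F n).filter (fun c => φ c = x)).card = Fintype.card F ^ (n - Q.natDegree) := by
  obtain ⟨r, rfl⟩ := hφ x
  simp only [hk]
  exact card_polysLT_filter hQ hn r

theorem card_Mn_filter_map [Fintype R] (hφ : Function.Surjective φ) (hk : ∀ x y, φ x = φ y ↔ Q ∣ x - y)
    (hQ : Q.Monic) {n : ℕ} (hn : Q.natDegree ≤ n) (p : R → Prop) :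
    ((Mn F n).filter (fun c => p (φ c))).card =
      (Finset.univ.filter p).card * Fintype.card F ^ (n - Q.natDegree) := by
  rw [Finset.card_eq_sum_card_fiberwise (f := φ) (t := Finset.univ.filter p)]
  · rw [Finset.sum_congr rfl (g := fun _ => Fintype.card F ^ (n - Q.natDegree)),
      Finset.sum_const, smul_eq_mul]
    intro x hx
    rw [← card_Mn_fibre hφ hk hQ hn x, Finset.filter_filter]
    congr 1
    refine Finset.filter_congr fun c _ => ?_
    simp only [Finset.mem_filter, Finset.mem_univ, true_and] at hx
    exact ⟨fun h => h.2, fun h => ⟨h ▸ hx, h⟩⟩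
  · intro c hc
    simpa using (Finset.mem_filter.1 hc).2

theorem card_eq_pow_natDegree [Fintype R] (hφ : Function.Surjective φ) (hk : ∀ x y, φ x = φ y ↔ Q ∣ x - y)
    (hQ : Q.Monic) : Fintype.card R = Fintype.card F ^ Q.natDegree := by
  have := card_Mn_filter_map hφ hk hQ le_rfl (fun _ => True)
  simpa [card_Mn] using this.symm

variable (F) in
/-- The triples of coefficients of the forms `(a, b, c)` with `a`, `c` monic of degrees `n`, `m`
and `b` of degree less than `n`. -/
noncomputable def triples (n m : ℕ) : Finset (F[X] × F[X] × F[X]) :=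
  Mn F n ×ˢ polysLT F n ×ˢ Mn F m

theorem card_triples (n m : ℕ) : (triples F n m).card = Fintype.card F ^ (n + n + m) := by
  rw [triples, Finset.card_product, Finset.card_product, card_Mn, card_Mn, card_polysLT]
  ring

theorem card_triples_filter_map [Fintype R] (hφ : Function.Surjective φ)
    (hk : ∀ x y, φ x = φ y ↔ Q ∣ x - y) (hQ : Q.Monic) {n m : ℕ} (hn : Q.natDegree ≤ n)
    (hm : Q.natDegree ≤ m) (p : R × R × R → Prop) :
    ((triples F n m).filter (fun t => p (φ t.1, φ t.2.1, φ t.2.2))).card =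
      (Finset.univ.filter p).card * Fintype.card F ^ ((n - Q.natDegree) + (n - Q.natDegree) +
        (m - Q.natDegree)) := by
  rw [Finset.card_eq_sum_card_fiberwise
    (f := fun t : F[X] × F[X] × F[X] => (φ t.1, φ t.2.1, φ t.2.2)) (t := Finset.univ.filter p)]
  · rw [Finset.sum_congr rfl, Finset.sum_const, smul_eq_mul]
    rintro ⟨x, y, z⟩ hx
    simp only [Finset.mem_filter, Finset.mem_univ, true_and] at hx
    rw [pow_add, pow_add, ← card_Mn_fibre hφ hk hQ hn x, ← card_Mn_fibre hφ hk hQ hm z]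
    nth_rewrite 2 [card_Mn_fibre hφ hk hQ hn x]
    rw [← card_polysLT_fibre hφ hk hQ hn y, mul_assoc, ← Finset.card_product,
      ← Finset.card_product]
    congr 1
    ext ⟨a, b, c⟩
    simp only [triples, Finset.mem_filter, Finset.mem_product, Prod.mk.injEq]
    constructor
    · rintro ⟨⟨⟨h1, h2, h3⟩, -⟩, h4, h5, h6⟩
      exact ⟨⟨h1, h4⟩, ⟨h2, h5⟩, h3, h6⟩
    · rintro ⟨⟨h1, h4⟩, ⟨h2, h5⟩, h3, h6⟩
      refine ⟨⟨⟨h1, h2, h3⟩, ?_⟩, h4, h5, h6⟩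
      rw [h4, h5, h6]; exact hx
  · intro c hc
    simpa using (Finset.mem_filter.1 hc).2

end Fibres

/-- The absolute value `|P| = q ^ deg P`, as a real number. -/
noncomputable def absNorm (P : F[X]) : ℝ := (Fintype.card F : ℝ) ^ P.natDegree

noncomputable instance quotientFintype (Q : F[X]) [NeZero Q] :
    Fintype (F[X] ⧸ Ideal.span {Q}) :=
  have : Finite (F[X] ⧸ Ideal.span {Q}) := by
    refine Finite.of_surjective
      (fun b : polysLT F Q.natDegree => Ideal.Quotient.mk (Ideal.span {Q}) b.1) ?_
    intro x
    obtain ⟨f, rfl⟩ := Ideal.Quotient.mk_surjective x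
    refine ⟨⟨f % Q, ?_⟩, ?_⟩
    · rw [mem_polysLT, ← degree_eq_natDegree (NeZero.ne Q)]
      exact EuclideanDomain.mod_lt _ (NeZero.ne Q)
    · rw [Ideal.Quotient.eq, Ideal.mem_span_singleton]
      refine ⟨-(f / Q), ?_⟩
      have := EuclideanDomain.div_add_mod f Q
      linear_combination this
  Fintype.ofFinite _

theorem card_quotient {Q : F[X]} [NeZero Q] (hQ : Q.Monic) :
    Fintype.card (F[X] ⧸ Ideal.span {Q}) = Fintype.card F ^ Q.natDegree :=
  card_eq_pow_natDegree Ideal.Quotient.mk_surjective (mk_eq_mk_iff_dvd Q) hQ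

theorem card_quadric_ne_zero {P : F[X]} [NeZero (P ^ 2)] (hP : P.Monic) (hi : Irreducible P) :
    ((Finset.univ.filter (fun t : (F[X] ⧸ Ideal.span {P ^ 2}) × (F[X] ⧸ Ideal.span {P ^ 2}) ×
      (F[X] ⧸ Ideal.span {P ^ 2}) => t.2.1 ^ 2 + t.1 * t.2.2 ≠ 0)).card : ℝ) =
      (1 - (absNorm P)⁻¹ ^ 2 - (absNorm P)⁻¹ ^ 3 + (absNorm P)⁻¹ ^ 4) *
        Fintype.card (F[X] ⧸ Ideal.span {P ^ 2}) ^ 3 := by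
  have : NeZero P := ⟨hi.ne_zero⟩
  have hmax : (Ideal.span {P}).IsMaximal :=
    PrincipalIdealRing.isMaximal_of_irreducible hi
  let _ : Field (F[X] ⧸ Ideal.span {P}) := Ideal.Quotient.field _
  have hle : Ideal.span {P ^ 2} ≤ Ideal.span {P} := by
    rw [Ideal.span_singleton_le_span_singleton]
    exact dvd_pow_self P two_ne_zero
  have hzero : ∀ f : F[X], Ideal.Quotient.factor hle (Ideal.Quotient.mk _ f) = 0 ↔ P ∣ f := by
    intro f
    rw [Ideal.Quotient.factor_mk, Ideal.Quotient.eq_zero_iff_mem, Ideal.mem_span_singleton]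
  have h := card_quadric_zeros (Ideal.Quotient.factor hle) (Ideal.Quotient.factor_surjective hle)
    (by
      intro x hx
      obtain ⟨f, rfl⟩ := Ideal.Quotient.mk_surjective x
      rw [Ne, hzero] at hx
      have hc : IsCoprime (P ^ 2) f := ((hi.coprime_iff_not_dvd).2 hx).pow_left
      obtain ⟨u, v, huv⟩ := hc
      refine IsUnit.of_mul_eq_one_right (Ideal.Quotient.mk _ v) ?_
      rw [← map_mul, ← map_one (Ideal.Quotient.mk _), mk_eq_mk_iff_dvd]
      exact ⟨-u, by linear_combination huv⟩)
    (by
      intro x y hx hy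
      obtain ⟨f, rfl⟩ := Ideal.Quotient.mk_surjective x
      obtain ⟨e, rfl⟩ := Ideal.Quotient.mk_surjective y
      rw [hzero] at hx hy
      rw [← map_mul, Ideal.Quotient.eq_zero_iff_mem, Ideal.mem_span_singleton, pow_two]
      exact mul_dvd_mul hx hy)
    (by rw [card_quotient (hP.pow 2), card_quotient hP, natDegree_pow, ← pow_mul, mul_comm])
  have h2 := Finset.card_filter_add_card_filter_not (s := Finset.univ) (fun t : (F[X] ⧸ Ideal.span {P ^ 2}) × (F[X] ⧸ Ideal.span {P ^ 2}) ×
      (F[X] ⧸ Ideal.span {P ^ 2}) => t.2.1 ^ 2 + t.1 * t.2.2 = 0)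
  rw [Finset.card_univ, Fintype.card_prod, Fintype.card_prod] at h2
  have h3 : (Fintype.card (F[X] ⧸ Ideal.span {P ^ 2}) : ℝ) = absNorm P ^ 2 := by
    rw [card_quotient (hP.pow 2), natDegree_pow, absNorm]
    push_cast
    ring
  have h4 : (Fintype.card (F[X] ⧸ Ideal.span {P}) : ℝ) = absNorm P := by
    rw [card_quotient hP, absNorm]
    push_cast
    ring
  have h5 : absNorm P ≠ 0 := pow_ne_zero _ (Nat.cast_ne_zero.2 Fintype.card_ne_zero)
  have h' := congrArg (Nat.cast : ℕ → ℝ) h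
  have h2' := congrArg (Nat.cast : ℕ → ℝ) h2
  push_cast at h' h2'
  rw [h4] at h'
  rw [h3] at h2' ⊢
  field_simp
  linear_combination h2' - h'

theorem card_quotient_ne_zero {P : F[X]} [NeZero (P ^ 2)] (hP : P.Monic) :
    ((Finset.univ.filter (fun x : F[X] ⧸ Ideal.span {P ^ 2} => x ≠ 0)).card : ℝ) =
      (1 - (absNorm P)⁻¹ ^ 2) * Fintype.card (F[X] ⧸ Ideal.span {P ^ 2}) := by
  have h3 : (Fintype.card (F[X] ⧸ Ideal.span {P ^ 2}) : ℝ) = absNorm P ^ 2 := by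
    rw [card_quotient (hP.pow 2), natDegree_pow, absNorm]
    push_cast
    ring
  have h5 : absNorm P ≠ 0 := pow_ne_zero _ (Nat.cast_ne_zero.2 Fintype.card_ne_zero)
  rw [Finset.filter_ne', Finset.cast_card_erase_of_mem (Finset.mem_univ _), Finset.card_univ, h3]
  field_simp

end Densities

/-- The monic irreducible polynomials. -/
abbrev MonicPrime (F : Type) [Field F] : Type := {P : F[X] // P.Monic ∧ Irreducible P}

section Sieve

variable {F : Type} [Field F]

instance (P : MonicPrime F) : NeZero (P.1 ^ 2) := ⟨pow_ne_zero 2 P.2.2.ne_zero⟩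

theorem isCoprime_sq {P P' : MonicPrime F} (h : P ≠ P') : IsCoprime (P.1 ^ 2) (P'.1 ^ 2) := by
  refine IsCoprime.pow ((P.2.2.coprime_iff_not_dvd).2 fun hd => h (Subtype.ext ?_))
  exact eq_of_monic_of_associated P.2.1 P'.2.1 (P.2.2.associated_of_dvd P'.2.2 hd)

/-- The reduction of a polynomial modulo all the squares `P²`, `P ∈ S`. -/
noncomputable def reductionHom (S : Finset (MonicPrime F)) :
    F[X] →+* ∀ P : S, F[X] ⧸ Ideal.span {P.1.1 ^ 2} :=
  RingHom.pi fun _ => Ideal.Quotient.mk _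

theorem reductionHom_surjective (S : Finset (MonicPrime F)) :
    Function.Surjective (reductionHom S) := by
  intro x
  have hco : Pairwise (Function.onFun IsCoprime fun P : S => Ideal.span {P.1.1 ^ 2}) := by
    intro P P' h
    rw [Function.onFun, Ideal.isCoprime_span_singleton_iff]
    exact isCoprime_sq fun h' => h (Subtype.ext h')
  obtain ⟨y, hy⟩ := Ideal.quotientInfToPiQuotient_surj hco x
  obtain ⟨f, rfl⟩ := Ideal.Quotient.mk_surjective y
  exact ⟨f, hy⟩

theorem reductionHom_eq_iff (S : Finset (MonicPrime F)) (x y : F[X]) :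
    reductionHom S x = reductionHom S y ↔ (∏ P ∈ S, P.1 ^ 2) ∣ x - y := by
  rw [funext_iff]
  constructor
  · intro h
    refine Finset.prod_dvd_of_coprime (fun P _ P' _ h' => isCoprime_sq h') fun P hP => ?_
    exact (mk_eq_mk_iff_dvd (P.1 ^ 2) x y).1 (h ⟨P, hP⟩)
  · intro h P
    exact (mk_eq_mk_iff_dvd (P.1.1 ^ 2) x y).2
      ((Finset.dvd_prod_of_mem (fun P : MonicPrime F => P.1 ^ 2) P.2).trans h)

theorem monic_prod_sq (S : Finset (MonicPrime F)) : (∏ P ∈ S, P.1 ^ 2).Monic :=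
  monic_prod_of_monic _ _ fun P _ => P.2.1.pow 2

theorem reductionHom_apply_ne_zero {S : Finset (MonicPrime F)} {f : F[X]} :
    (∀ P, reductionHom S f P ≠ 0) ↔ ∀ P ∈ S, ¬ P.1 ^ 2 ∣ f := by
  have : ∀ P : S, reductionHom S f P ≠ 0 ↔ ¬ P.1.1 ^ 2 ∣ f := fun P => by
    change Ideal.Quotient.mk _ f ≠ 0 ↔ _
    rw [Ne, Ideal.Quotient.eq_zero_iff_mem, Ideal.mem_span_singleton]
  simp only [this, Subtype.forall]

/-- The local density of triples with `b² + ac` not divisible by `P²`. -/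
noncomputable def localFactor [Fintype F] (P : F[X]) : ℝ :=
  1 - (absNorm P)⁻¹ ^ 2 - (absNorm P)⁻¹ ^ 3 + (absNorm P)⁻¹ ^ 4

variable [Fintype F]

theorem card_triples_sieve (S : Finset (MonicPrime F)) {n m : ℕ}
    (hn : (∏ P ∈ S, P.1 ^ 2).natDegree ≤ n) (hm : (∏ P ∈ S, P.1 ^ 2).natDegree ≤ m) :
    (((triples F n m).filter
      (fun t => ∀ P ∈ S, ¬ P.1 ^ 2 ∣ t.2.1 ^ 2 + t.1 * t.2.2)).card : ℝ) =
      (∏ P ∈ S, localFactor P.1) * (Fintype.card F : ℝ) ^ (n + n + m) := by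
  have h := card_triples_filter_map (reductionHom_surjective S) (reductionHom_eq_iff S)
    (monic_prod_sq S) hn hm (fun t => ∀ P, (t.2.1 ^ 2 + t.1 * t.2.2) P ≠ 0)
  have hc : Fintype.card (∀ P : S, F[X] ⧸ Ideal.span {P.1.1 ^ 2}) = _ :=
    card_eq_pow_natDegree (reductionHom_surjective S) (reductionHom_eq_iff S) (monic_prod_sq S)
  simp only [← map_mul, ← map_pow, ← map_add, reductionHom_apply_ne_zero] at h
  rw [h]
  have h2 : (@Finset.filter _ (fun t : (∀ P : S, F[X] ⧸ Ideal.span {P.1.1 ^ 2}) ×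
      (∀ P : S, F[X] ⧸ Ideal.span {P.1.1 ^ 2}) × (∀ P : S, F[X] ⧸ Ideal.span {P.1.1 ^ 2}) =>
      ∀ P, (t.2.1 ^ 2 + t.1 * t.2.2) P ≠ 0) (fun _ => Classical.propDecidable _)
      Finset.univ).card =
      ∏ P : S, (Finset.univ.filter (fun t : (F[X] ⧸ Ideal.span {P.1.1 ^ 2}) ×
        (F[X] ⧸ Ideal.span {P.1.1 ^ 2}) × (F[X] ⧸ Ideal.span {P.1.1 ^ 2}) =>
        t.2.1 ^ 2 + t.1 * t.2.2 ≠ 0)).card := by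
    rw [← Fintype.card_piFinset]
    refine Finset.card_bij' (fun t _ P => (t.1 P, t.2.1 P, t.2.2 P))
      (fun s _ => (fun P => (s P).1, fun P => (s P).2.1, fun P => (s P).2.2)) ?_ ?_ ?_ ?_
    · intro t ht
      simpa using ht
    · intro t ht
      simpa using ht
    · intro t _
      rfl
    · intro t _
      rfl
  rw [h2]
  push_cast
  rw [Finset.prod_congr rfl (fun (P : S) _ => card_quadric_ne_zero P.1.2.1 P.1.2.2),
    Finset.prod_mul_distrib, Finset.prod_pow]
  rw [Fintype.card_pi] at hc
  have hc' := congrArg (Nat.cast : ℕ → ℝ) hc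
  push_cast at hc'
  rw [hc', Finset.prod_coe_sort S (fun P => (1 - (absNorm P.1)⁻¹ ^ 2 - (absNorm P.1)⁻¹ ^ 3 +
    (absNorm P.1)⁻¹ ^ 4)), mul_assoc, ← pow_mul, ← pow_add]
  congr 2
  omega

theorem card_Mn_sieve (S : Finset (MonicPrime F)) {n : ℕ}
    (hn : (∏ P ∈ S, P.1 ^ 2).natDegree ≤ n) :
    (((Mn F n).filter (fun D => ∀ P ∈ S, ¬ P.1 ^ 2 ∣ D)).card : ℝ) =
      (∏ P ∈ S, (1 - (absNorm P.1)⁻¹ ^ 2)) * (Fintype.card F : ℝ) ^ n := by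
  have h := card_Mn_filter_map (reductionHom_surjective S) (reductionHom_eq_iff S)
    (monic_prod_sq S) hn (fun x => ∀ P, x P ≠ 0)
  have hc : Fintype.card (∀ P : S, F[X] ⧸ Ideal.span {P.1.1 ^ 2}) = _ :=
    card_eq_pow_natDegree (reductionHom_surjective S) (reductionHom_eq_iff S) (monic_prod_sq S)
  simp only [reductionHom_apply_ne_zero] at h
  rw [h]
  have h2 : (@Finset.filter _ (fun x : (∀ P : S, F[X] ⧸ Ideal.span {P.1.1 ^ 2}) =>
      ∀ P, x P ≠ 0) (fun _ => Classical.propDecidable _) Finset.univ).card =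
      ∏ P : S, (Finset.univ.filter (fun x : F[X] ⧸ Ideal.span {P.1.1 ^ 2} => x ≠ 0)).card := by
    rw [← Fintype.card_piFinset]
    congr 1
    ext x
    simp
  rw [h2]
  push_cast
  rw [Finset.prod_congr rfl (fun (P : S) _ => card_quotient_ne_zero P.1.2.1),
    Finset.prod_mul_distrib]
  rw [Fintype.card_pi] at hc
  have hc' := congrArg (Nat.cast : ℕ → ℝ) hc
  push_cast at hc'
  rw [hc', Finset.prod_coe_sort S (fun P => (1 - (absNorm P.1)⁻¹ ^ 2)), mul_assoc, ← pow_add]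
  congr 2
  omega

end Sieve

section Tail

theorem squarefree_iff_forall_monicPrime {F : Type} [Field F] {f : F[X]} (hf : f ≠ 0) :
    Squarefree f ↔ ∀ P : MonicPrime F, ¬ P.1 ^ 2 ∣ f := by
  constructor
  · intro h P hd
    rw [pow_two] at hd
    exact P.2.2.not_isUnit (h _ hd)
  · intro h
    rw [squarefree_iff_irreducible_sq_not_dvd_of_ne_zero hf]
    intro p hp hd
    refine h ⟨normalize p, monic_normalize hp.ne_zero,
      (normalize_associated p).symm.irreducible hp⟩ ?_
    rw [pow_two]
    exact ((normalize_associated p).mul_mul (normalize_associated p)).dvd.trans hd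

theorem card_monic_divisors_le {F : Type} [Field F] {M : F[X]} (hM : M ≠ 0)
    (T : Finset F[X]) (hT : ∀ a ∈ T, a.Monic ∧ a ∣ M) : T.card ≤ 2 ^ M.natDegree := by
  have hprod : ∀ a : F[X], a.Monic → (normalizedFactors a).prod = a := fun a ha => by
    have hm : ((normalizedFactors a).map id).prod.Monic :=
      monic_multiset_prod_of_monic _ _ fun p hp => by
        rw [id, ← normalize_normalized_factor p hp]
        exact monic_normalize (irreducible_of_normalized_factor p hp).ne_zero
    rw [Multiset.map_id] at hm
    exact eq_of_monic_of_associated hm ha (prod_normalizedFactors ha.ne_zero)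
  have hcard : (normalizedFactors M).card ≤ M.natDegree := by
    rw [← natDegree_eq_of_degree_eq (degree_eq_degree_of_associated (prod_normalizedFactors hM)),
      natDegree_multiset_prod _ (zero_notMem_normalizedFactors M)]
    have := Multiset.card_nsmul_le_sum (s := (normalizedFactors M).map natDegree) (a := 1)
      (by
        intro x hx
        obtain ⟨p, hp, rfl⟩ := Multiset.mem_map.1 hx
        exact (irreducible_of_normalized_factor p hp).natDegree_pos)
    simpa using this
  calc T.card ≤ ((normalizedFactors M).powerset.toFinset).card := by
        refine Finset.card_le_card_of_injOn normalizedFactors ?_ ?_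
        · intro a ha
          simp only [SetLike.mem_coe, Multiset.mem_toFinset, Multiset.mem_powerset]
          exact (dvd_iff_normalizedFactors_le_normalizedFactors (hT a ha).1.ne_zero hM).1
            (hT a ha).2
        · intro a ha a' ha' h
          rw [← hprod a (hT a ha).1, ← hprod a' (hT a' ha').1, h]
    _ ≤ 2 ^ (normalizedFactors M).card := by
        rw [← Multiset.card_powerset]
        exact Multiset.toFinset_card_le _
    _ ≤ 2 ^ M.natDegree := Nat.pow_le_pow_right (by norm_num) hcard

variable {F : Type} [Field F] [Fintype F]

variable (F) in
/-- The monic irreducible polynomials of degree `k`. -/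
noncomputable def primesOfDegree (k : ℕ) : Finset F[X] := (Mn F k).filter Irreducible

theorem mem_primesOfDegree {k : ℕ} {P : F[X]} :
    P ∈ primesOfDegree F k ↔ P.Monic ∧ P.natDegree = k ∧ Irreducible P := by
  simp [primesOfDegree, mem_Mn, and_assoc]

theorem card_primesOfDegree_le (k : ℕ) : (primesOfDegree F k).card ≤ Fintype.card F ^ k :=
  (Finset.card_filter_le _ _).trans (card_Mn k).le

theorem card_Mn_bad_le {N k : ℕ} (hk : 2 * k ≤ N) :
    (((Mn F N).filter (fun D => ∃ P ∈ primesOfDegree F k, P ^ 2 ∣ D)).card : ℝ) ≤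
      ((Fintype.card F : ℝ) ^ k)⁻¹ * (Fintype.card F : ℝ) ^ N := by
  have hq : (0 : ℝ) < Fintype.card F := Nat.cast_pos.2 Fintype.card_pos
  have h1 : ((Mn F N).filter (fun D => ∃ P ∈ primesOfDegree F k, P ^ 2 ∣ D)).card ≤
      Fintype.card F ^ k * Fintype.card F ^ (N - 2 * k) := by
    have : (Mn F N).filter (fun D => ∃ P ∈ primesOfDegree F k, P ^ 2 ∣ D) ⊆
        (primesOfDegree F k).biUnion fun P => (Mn F N).filter (fun D => P ^ 2 ∣ D - 0) := by
      intro D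
      simp only [Finset.mem_filter, Finset.mem_biUnion, sub_zero]
      rintro ⟨hD, P, hP, hd⟩
      exact ⟨P, hP, hD, hd⟩
    refine (Finset.card_le_card this).trans (Finset.card_biUnion_le.trans ?_)
    refine (Finset.sum_le_card_nsmul _ _ (Fintype.card F ^ (N - 2 * k)) ?_).trans ?_
    · intro P hP
      obtain ⟨h1, h2, -⟩ := mem_primesOfDegree.1 hP
      have := card_Mn_filter_le (h1.pow 2) N 0
      rwa [natDegree_pow, h2] at this
    · rw [smul_eq_mul]
      exact Nat.mul_le_mul_right _ (card_primesOfDegree_le k)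
  calc _ ≤ (((Fintype.card F ^ k * Fintype.card F ^ (N - 2 * k) : ℕ)) : ℝ) := by exact_mod_cast h1
    _ = _ := by
      push_cast
      obtain ⟨l, rfl⟩ := Nat.exists_eq_add_of_le hk
      rw [Nat.add_sub_cancel_left]
      field_simp
      ring

theorem card_polysLT_pair_le {P : F[X]} (hP : P.Monic) (n : ℕ) :
    ((((Mn F n).filter (fun a => P ∣ a)).card * ((polysLT F n).filter (fun b => P ∣ b)).card
      : ℕ) : ℝ) ≤ (Fintype.card F : ℝ) ^ (n + n) * (((Fintype.card F : ℝ) ^ P.natDegree)⁻¹) ^ 2 := by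
  have hq : (0 : ℝ) < Fintype.card F := Nat.cast_pos.2 Fintype.card_pos
  by_cases h : P.natDegree ≤ n
  · have h1 := card_Mn_filter hP h 0
    have h2 := card_polysLT_filter hP h 0
    simp only [sub_zero] at h1 h2
    rw [h1, h2]
    push_cast
    obtain ⟨l, rfl⟩ := Nat.exists_eq_add_of_le h
    rw [Nat.add_sub_cancel_left]
    apply le_of_eq
    field_simp
    ring
  · have h1 : (Mn F n).filter (fun a => P ∣ a) = ∅ := by
      refine Finset.filter_eq_empty_iff.2 fun a ha hd => h ?_
      obtain ⟨h3, rfl⟩ := mem_Mn.1 ha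
      exact natDegree_le_of_dvd hd h3.ne_zero
    rw [h1]
    simp only [Finset.card_empty, zero_mul, Nat.cast_zero]
    positivity

variable (F) in
/-- The triples `(a, b, c)` with `b² + ac` divisible by the square of a prime of degree `k`. -/
noncomputable def badTriples (n m k : ℕ) : Finset (F[X] × F[X] × F[X]) :=
  (triples F n m).filter fun t => ∃ P ∈ primesOfDegree F k, P ^ 2 ∣ t.2.1 ^ 2 + t.1 * t.2.2

theorem card_Mn_sq_dvd_le {P a b : F[X]} (hP : P.Monic) (hi : Irreducible P) (ha : ¬ P ∣ a)
    (m : ℕ) : ((Mn F m).filter (fun c => P ^ 2 ∣ b ^ 2 + a * c)).card ≤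
      Fintype.card F ^ (m - 2 * P.natDegree) := by
  obtain ⟨u, v, huv⟩ : IsCoprime (P ^ 2) a := ((hi.coprime_iff_not_dvd).2 ha).pow_left
  have h := card_Mn_filter_le (hP.pow 2) m (-(v * b ^ 2))
  rw [natDegree_pow] at h
  refine (Finset.card_le_card ?_).trans h
  refine Finset.monotone_filter_right _ fun c _ hc => ?_
  have : c - -(v * b ^ 2) = v * (b ^ 2 + a * c) + P ^ 2 * (u * c) := by
    linear_combination (-c) * huv
  rw [this]
  exact dvd_add (hc.mul_left _) (dvd_mul_right _ _)

theorem card_badTriples_le_add (n m k : ℕ) :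
    ((badTriples F n m k).card : ℝ) ≤ (2 * ((Fintype.card F : ℝ) ^ k)⁻¹ +
      (Fintype.card F : ℝ) ^ k * ((Fintype.card F : ℝ) ^ m)⁻¹) *
        (Fintype.card F : ℝ) ^ (n + n + m) := by
  have hq : (0 : ℝ) < Fintype.card F := Nat.cast_pos.2 Fintype.card_pos
  have hq1 : (1 : ℝ) ≤ Fintype.card F := Nat.one_le_cast.2 Fintype.card_pos
  set q : ℝ := (Fintype.card F : ℝ) with hqdef
  have hpow : ((Fintype.card F ^ (m - 2 * k) : ℕ) : ℝ) ≤ q ^ m * ((q ^ k)⁻¹) ^ 2 + 1 := by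
    push_cast
    rw [← hqdef]
    by_cases h : 2 * k ≤ m
    · obtain ⟨l, rfl⟩ := Nat.exists_eq_add_of_le h
      rw [Nat.add_sub_cancel_left, pow_add, mul_comm 2 k, pow_mul]
      field_simp
      nlinarith [sq_nonneg (q ^ k)]
    · rw [Nat.sub_eq_zero_of_le (by omega), pow_zero]
      have : 0 ≤ q ^ m * ((q ^ k)⁻¹) ^ 2 := by positivity
      linarith
  have hsub : badTriples F n m k ⊆ (primesOfDegree F k).biUnion fun P =>
      (triples F n m).filter (fun t => ¬ P ∣ t.1 ∧ P ^ 2 ∣ t.2.1 ^ 2 + t.1 * t.2.2) ∪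
        ((Mn F n).filter (fun a => P ∣ a) ×ˢ (polysLT F n).filter (fun b => P ∣ b) ×ˢ Mn F m) := by
    intro t
    simp only [badTriples, triples, Finset.mem_filter, Finset.mem_biUnion, Finset.mem_union,
      Finset.mem_product]
    rintro ⟨⟨ha, hb, hc⟩, P, hP, hd⟩
    refine ⟨P, hP, ?_⟩
    by_cases h : P ∣ t.1
    · refine Or.inr ⟨⟨ha, h⟩, ⟨hb, ?_⟩, hc⟩
      have h2 : P ∣ t.2.1 ^ 2 :=
        (dvd_add_left (h.mul_right _)).1 ((dvd_pow_self P two_ne_zero).trans hd)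
      exact (mem_primesOfDegree.1 hP).2.2.prime.dvd_of_dvd_pow h2
    · exact Or.inl ⟨⟨ha, hb, hc⟩, h, hd⟩
  have hP : ∀ P ∈ primesOfDegree F k,
      ((((triples F n m).filter (fun t => ¬ P ∣ t.1 ∧ P ^ 2 ∣ t.2.1 ^ 2 + t.1 * t.2.2) ∪
        ((Mn F n).filter (fun a => P ∣ a) ×ˢ (polysLT F n).filter (fun b => P ∣ b) ×ˢ
          Mn F m)).card : ℕ) : ℝ) ≤
        q ^ (n + n) * (q ^ m * ((q ^ k)⁻¹) ^ 2 + 1) + q ^ (n + n) * ((q ^ k)⁻¹) ^ 2 * q ^ m := by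
    intro P hP
    obtain ⟨h1, h2, h3⟩ := mem_primesOfDegree.1 hP
    refine (Nat.cast_le.2 (Finset.card_union_le _ _)).trans ?_
    push_cast
    refine add_le_add ?_ ?_
    · have : ((triples F n m).filter
          (fun t => ¬ P ∣ t.1 ∧ P ^ 2 ∣ t.2.1 ^ 2 + t.1 * t.2.2)).card ≤
          Fintype.card F ^ (n + n) * Fintype.card F ^ (m - 2 * k) := by
        have e : (triples F n m).filter
            (fun t => ¬ P ∣ t.1 ∧ P ^ 2 ∣ t.2.1 ^ 2 + t.1 * t.2.2) ⊆
            (Mn F n ×ˢ polysLT F n).biUnion fun s =>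
              ((Mn F m).filter (fun c => ¬ P ∣ s.1 ∧ P ^ 2 ∣ s.2 ^ 2 + s.1 * c)).image
                fun c => (s.1, s.2, c) := by
          rintro ⟨a, b, c⟩
          simp only [triples, Finset.mem_filter, Finset.mem_biUnion, Finset.mem_product,
            Finset.mem_image]
          rintro ⟨⟨ha, hb, hc⟩, h⟩
          exact ⟨(a, b), ⟨ha, hb⟩, c, ⟨hc, h⟩, rfl⟩
        refine (Finset.card_le_card e).trans (Finset.card_biUnion_le.trans ?_)
        refine (Finset.sum_le_card_nsmul _ _ (Fintype.card F ^ (m - 2 * k)) ?_).trans ?_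
        · rintro ⟨a, b⟩ -
          refine Finset.card_image_le.trans ?_
          by_cases ha : P ∣ a
          · simp [ha]
          · simp only [ha, not_false_eq_true, true_and]
            rw [← h2]
            exact card_Mn_sq_dvd_le h1 h3 ha m
        · rw [Finset.card_product, card_Mn, card_polysLT, smul_eq_mul, pow_add]
      refine (Nat.cast_le.2 this).trans ?_
      rw [Nat.cast_mul]
      refine mul_le_mul (by push_cast; rfl) hpow (by positivity) (by positivity)
    · rw [Finset.card_product, Finset.card_product, ← mul_assoc, card_Mn, Nat.cast_mul]
      have := card_polysLT_pair_le h1 n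
      rw [h2] at this
      refine mul_le_mul this (by push_cast; rfl) (by positivity) (by positivity)
  calc ((badTriples F n m k).card : ℝ) ≤ _ := Nat.cast_le.2 (Finset.card_le_card hsub)
    _ ≤ _ := Nat.cast_le.2 Finset.card_biUnion_le
    _ ≤ (primesOfDegree F k).card • (q ^ (n + n) * (q ^ m * ((q ^ k)⁻¹) ^ 2 + 1) +
        q ^ (n + n) * ((q ^ k)⁻¹) ^ 2 * q ^ m) := by
      rw [Nat.cast_sum]
      exact Finset.sum_le_card_nsmul _ _ _ hP
    _ ≤ q ^ k * (q ^ (n + n) * (q ^ m * ((q ^ k)⁻¹) ^ 2 + 1) +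
        q ^ (n + n) * ((q ^ k)⁻¹) ^ 2 * q ^ m) := by
      rw [nsmul_eq_mul]
      refine mul_le_mul_of_nonneg_right ?_ (by positivity)
      rw [hqdef]
      exact_mod_cast card_primesOfDegree_le (F := F) k
    _ = _ := by
      rw [pow_add q (n + n) m]
      field_simp
      ring

theorem natDegree_sq_add_mul {n m : ℕ} (hnm : n ≤ m) {t : F[X] × F[X] × F[X]}
    (ht : t ∈ triples F n m) : t.2.1 ^ 2 + t.1 * t.2.2 ∈ Mn F (n + m) := by
  obtain ⟨a, b, c⟩ := t
  simp only [triples, Finset.mem_product, mem_Mn, mem_polysLT] at ht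
  obtain ⟨⟨ha, rfl⟩, hb, hc, rfl⟩ := ht
  have hdeg : (b ^ 2).degree < (a * c).degree := by
    rw [degree_mul, pow_two, degree_mul, degree_eq_natDegree ha.ne_zero,
      degree_eq_natDegree hc.ne_zero]
    by_cases hb0 : b = 0
    · simp [hb0, ← Nat.cast_add]
    · rw [degree_eq_natDegree hb0] at hb ⊢
      norm_cast at hb ⊢
      omega
  rw [mem_Mn]
  simp only
  refine ⟨(ha.mul hc).add_of_right hdeg, ?_⟩
  rw [natDegree_add_eq_right_of_degree_lt hdeg, ha.natDegree_mul hc]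

theorem card_badTriples_le_mul {n m k : ℕ} (hnm : n ≤ m) (hk : 2 * k ≤ n + m) :
    ((badTriples F n m k).card : ℝ) ≤ (((Fintype.card F : ℝ) ^ k)⁻¹ * 2 ^ (n + m)) *
        (Fintype.card F : ℝ) ^ (n + n + m) := by
  have hq : (0 : ℝ) < Fintype.card F := Nat.cast_pos.2 Fintype.card_pos
  have h1 := Finset.card_le_mul_card_image
    (f := fun t : F[X] × F[X] × F[X] => (t.2.1, t.2.1 ^ 2 + t.1 * t.2.2))
    (badTriples F n m k) (2 ^ (n + m)) (by
      intro s hs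
      obtain ⟨⟨a₀, b₀, c₀⟩, ht, rfl⟩ := Finset.mem_image.1 hs
      have ht' := (Finset.mem_filter.1 ht).1
      simp only [triples, Finset.mem_product, mem_Mn, mem_polysLT] at ht'
      obtain ⟨⟨ha, rfl⟩, -, hc, rfl⟩ := ht'
      rw [← ha.natDegree_mul hc]
      have hinj : Set.InjOn (fun t : F[X] × F[X] × F[X] => t.1) ((badTriples F a₀.natDegree
          c₀.natDegree k).filter (fun t => (t.2.1, t.2.1 ^ 2 + t.1 * t.2.2) =
            (b₀, b₀ ^ 2 + a₀ * c₀))) := by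
        rintro ⟨a, b, c⟩ h ⟨a', b', c'⟩ h' haa
        simp only [badTriples, triples, Finset.coe_filter, Finset.mem_filter, Finset.mem_product,
          mem_Mn, Prod.mk.injEq, Set.mem_ofPred_eq] at h h' haa
        subst haa
        obtain ⟨⟨⟨⟨h1, -⟩, -⟩, -⟩, rfl, h2⟩ := h
        obtain ⟨-, rfl, h3⟩ := h'
        rw [← h3, add_right_inj] at h2
        rw [mul_left_cancel₀ h1.ne_zero h2]
      rw [← Finset.card_image_of_injOn hinj]
      refine card_monic_divisors_le (ha.mul hc).ne_zero _ ?_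
      intro a' h'
      obtain ⟨⟨a, b, c⟩, h, rfl⟩ := Finset.mem_image.1 h'
      simp only [badTriples, triples, Finset.mem_filter, Finset.mem_product,
          mem_Mn, Prod.mk.injEq] at h
      obtain ⟨⟨⟨⟨h1, -⟩, -⟩, -⟩, rfl, h2⟩ := h
      rw [add_right_inj] at h2
      exact ⟨h1, h2 ▸ dvd_mul_right _ _⟩)
  have h2 : (badTriples F n m k).image (fun t => (t.2.1, t.2.1 ^ 2 + t.1 * t.2.2)) ⊆
      polysLT F n ×ˢ
        (Mn F (n + m)).filter (fun D => ∃ P ∈ primesOfDegree F k, P ^ 2 ∣ D) := by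
    intro s hs
    obtain ⟨t, ht, rfl⟩ := Finset.mem_image.1 hs
    obtain ⟨ht, hP⟩ := Finset.mem_filter.1 ht
    refine Finset.mem_product.2 ⟨?_, Finset.mem_filter.2 ⟨natDegree_sq_add_mul hnm ht, hP⟩⟩
    exact (Finset.mem_product.1 (Finset.mem_product.1 ht).2).1
  have h3 := h1.trans (Nat.mul_le_mul_left _ (Finset.card_le_card h2))
  rw [Finset.card_product, card_polysLT] at h3
  refine (Nat.cast_le.2 h3).trans ?_
  push_cast
  calc _ ≤ (2 : ℝ) ^ (n + m) * ((Fintype.card F : ℝ) ^ n *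
        (((Fintype.card F : ℝ) ^ k)⁻¹ * (Fintype.card F : ℝ) ^ (n + m))) := by
        gcongr
        exact card_Mn_bad_le hk
    _ = _ := by ring

end Tail

section Limits

/-- A sieve limit: if `t` is squeezed between sifted densities `u K` up to a geometric tail and an
error `η`, then `t` converges to the limit of the sifted densities. -/
theorem tendsto_of_sieve {t η : ℕ → ℝ} {u : ℕ → ℕ → ℝ} {V : ℕ → ℝ} {v r : ℝ} (hr0 : 0 ≤ r)
    (hr1 : r < 1) (hle : ∀ K g, t g ≤ u K g)
    (hge : ∀ K, ∀ᶠ g in Filter.atTop,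
      u K g ≤ t g + ∑ k ∈ Finset.Ico (K + 1) (g + 1), (2 * r ^ k + η g))
    (hu : ∀ K, ∀ᶠ g in Filter.atTop, u K g = V K)
    (hη0 : ∀ g, 0 ≤ η g)
    (hη : Filter.Tendsto (fun g : ℕ => (g : ℝ) * η g) Filter.atTop (nhds 0))
    (hV : Filter.Tendsto V Filter.atTop (nhds v)) : Filter.Tendsto t Filter.atTop (nhds v) := by
  rw [Metric.tendsto_atTop]
  intro ε hε
  have h1r : 0 < 1 - r := by linarith
  have hgeo : Filter.Tendsto (fun K : ℕ => 2 * (r ^ (K + 1) / (1 - r))) Filter.atTop (nhds 0) := by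
    have := (((tendsto_pow_atTop_nhds_zero_of_lt_one hr0 hr1).comp
      (Filter.tendsto_add_atTop_nat 1)).div_const (1 - r)).const_mul 2
    simpa using this
  obtain ⟨K, hK1, hK2⟩ := ((hV.eventually (Metric.ball_mem_nhds v (by linarith : 0 < ε / 3))).and
    (hgeo.eventually (Metric.ball_mem_nhds 0 (by linarith : 0 < ε / 3)))).exists
  obtain ⟨G, hG⟩ := Filter.eventually_atTop.1 ((hge K).and ((hu K).and
    (hη.eventually (Metric.ball_mem_nhds 0 (by linarith : 0 < ε / 3)))))
  refine ⟨G, fun g hg => ?_⟩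
  obtain ⟨h1, h2, h3⟩ := hG g hg
  simp only [Real.dist_eq, sub_zero, abs_lt] at hK1 hK2 h3 ⊢
  have h4 := hle K g
  have h5 : ∑ k ∈ Finset.Ico (K + 1) (g + 1), (2 * r ^ k + η g) ≤
      2 * (r ^ (K + 1) / (1 - r)) + g * η g := by
    rw [Finset.sum_add_distrib, ← Finset.mul_sum, Finset.sum_const, Nat.card_Ico, nsmul_eq_mul]
    refine add_le_add ?_ ?_
    · exact mul_le_mul_of_nonneg_left (geom_sum_Ico_le_of_lt_one hr0 hr1) (by norm_num)
    · refine mul_le_mul_of_nonneg_right ?_ (hη0 g)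
      exact Nat.cast_le.2 (by omega)
  constructor <;> linarith [hK1.1, hK1.2, hK2.2, h3.2]

variable {F : Type} [Field F] [Fintype F]

theorem finite_monicPrime_natDegree_le (K : ℕ) :
    {P : MonicPrime F | P.1.natDegree ≤ K}.Finite := by
  refine Set.Finite.of_finite_image (f := Subtype.val) ?_ Subtype.val_injective.injOn
  refine (polysLT F (K + 1)).finite_toSet.subset ?_
  rintro _ ⟨P, hP, rfl⟩
  simp only [SetLike.mem_coe, mem_polysLT]
  rw [degree_eq_natDegree P.2.2.ne_zero]
  exact_mod_cast Nat.lt_succ_of_le hP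

variable (F) in
/-- The monic irreducible polynomials of degree at most `K`. -/
noncomputable def smallPrimes (K : ℕ) : Finset (MonicPrime F) :=
  (finite_monicPrime_natDegree_le K).toFinset

theorem mem_smallPrimes {K : ℕ} {P : MonicPrime F} :
    P ∈ smallPrimes F K ↔ P.1.natDegree ≤ K := by
  simp [smallPrimes]

theorem tendsto_smallPrimes : Filter.Tendsto (smallPrimes F) Filter.atTop Filter.atTop := by
  refine Filter.tendsto_atTop_finset_of_monotone ?_ fun P => ⟨P.1.natDegree, mem_smallPrimes.2 le_rfl⟩
  intro K K' h P
  simp only [mem_smallPrimes]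
  exact fun h' => h'.trans h

theorem card_filter_squarefree_le {α : Type*} (X : Finset α) (v : α → F[X]) {N : ℕ}
    (hv : ∀ x ∈ X, v x ∈ Mn F N) (S : Finset (MonicPrime F)) :
    (X.filter fun x => Squarefree (v x)).card ≤
      (X.filter fun x => ∀ P ∈ S, ¬ P.1 ^ 2 ∣ v x).card := by
  refine Finset.card_le_card fun x hx => ?_
  rw [Finset.mem_filter] at hx ⊢
  refine ⟨hx.1, fun P _ => ?_⟩
  exact (squarefree_iff_forall_monicPrime (mem_Mn.1 (hv x hx.1)).1.ne_zero).1 hx.2 P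

theorem card_filter_sieve_le {α : Type*} (X : Finset α) (v : α → F[X]) {g : ℕ}
    (hv : ∀ x ∈ X, v x ∈ Mn F (2 * g + 1)) (K : ℕ) :
    (X.filter fun x => ∀ P ∈ smallPrimes F K, ¬ P.1 ^ 2 ∣ v x).card ≤
      (X.filter fun x => Squarefree (v x)).card +
        ∑ k ∈ Finset.Ico (K + 1) (g + 1),
          (X.filter fun x => ∃ P ∈ primesOfDegree F k, P ^ 2 ∣ v x).card := by
  refine le_trans ?_ (Nat.add_le_add_left Finset.card_biUnion_le _)
  refine le_trans (Finset.card_le_card ?_) (Finset.card_union_le _ _)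
  intro x hx
  rw [Finset.mem_filter] at hx
  rw [Finset.mem_union, Finset.mem_filter, Finset.mem_biUnion]
  by_cases h : Squarefree (v x)
  · exact Or.inl ⟨hx.1, h⟩
  · right
    obtain ⟨hm, hd⟩ := mem_Mn.1 (hv x hx.1)
    rw [squarefree_iff_forall_monicPrime hm.ne_zero] at h
    push Not at h
    obtain ⟨P, hP⟩ := h
    have h1 : ¬ P.1.natDegree ≤ K := fun h' => hx.2 P (mem_smallPrimes.2 h') hP
    have h2 := natDegree_le_of_dvd hP hm.ne_zero
    rw [natDegree_pow, hd] at h2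
    exact ⟨P.1.natDegree, Finset.mem_Ico.2 ⟨by omega, by omega⟩,
      Finset.mem_filter.2 ⟨hx.1, P.1, mem_primesOfDegree.2 ⟨P.2.1, rfl, P.2.2⟩, hP⟩⟩

theorem summable_absNorm_inv_sq : Summable fun P : MonicPrime F => (absNorm P.1)⁻¹ ^ 2 := by
  have hq : (0 : ℝ) < Fintype.card F := Nat.cast_pos.2 Fintype.card_pos
  have hr1 : (Fintype.card F : ℝ)⁻¹ < 1 := inv_lt_one_of_one_lt₀
    (Nat.one_lt_cast.2 Fintype.one_lt_card)
  have hr0 : (0 : ℝ) ≤ (Fintype.card F : ℝ)⁻¹ := by positivity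
  refine summable_of_sum_le (c := (1 - (Fintype.card F : ℝ)⁻¹)⁻¹) (fun P => by positivity) ?_
  intro u
  obtain ⟨M, hM⟩ : ∃ M, ∀ P ∈ u, P.1.natDegree ∈ Finset.range M :=
    ⟨u.sup (fun P => P.1.natDegree) + 1, fun P hP => by
      rw [Finset.mem_range]
      exact Nat.lt_succ_of_le (Finset.le_sup (f := fun P : MonicPrime F => P.1.natDegree) hP)⟩
  rw [← Finset.sum_fiberwise_of_maps_to hM]
  calc _ ≤ ∑ k ∈ Finset.range M, ((Fintype.card F : ℝ)⁻¹) ^ k := by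
        refine Finset.sum_le_sum fun k _ => ?_
        rw [Finset.sum_congr rfl (g := fun _ => (((Fintype.card F : ℝ) ^ k)⁻¹) ^ 2),
          Finset.sum_const, nsmul_eq_mul]
        · have : (u.filter fun P => P.1.natDegree = k).card ≤ Fintype.card F ^ k := by
            refine le_trans ?_ (card_primesOfDegree_le (F := F) k)
            refine Finset.card_le_card_of_injOn Subtype.val ?_ Subtype.val_injective.injOn
            intro P hP
            exact mem_primesOfDegree.2 ⟨P.2.1, (Finset.mem_filter.1 hP).2, P.2.2⟩
          have h' : ((u.filter fun P => P.1.natDegree = k).card : ℝ) ≤ (Fintype.card F : ℝ) ^ k := by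
            exact_mod_cast this
          refine (mul_le_mul_of_nonneg_right h' (by positivity)).trans (le_of_eq ?_)
          rw [inv_pow _ k, pow_two, mul_inv_cancel_left₀ (pow_ne_zero k hq.ne')]
        · intro P hP
          rw [absNorm, (Finset.mem_filter.1 hP).2]
    _ ≤ _ := by
        have := geom_sum_Ico_le_of_lt_one (m := 0) (n := M) hr0 hr1
        rw [← Finset.range_eq_Ico, pow_zero, one_div] at this
        exact this

variable (F) in
theorem one_lt_card_cast : (1 : ℝ) < Fintype.card F := Nat.one_lt_cast.2 Fintype.one_lt_card

theorem one_lt_absNorm (P : MonicPrime F) : 1 < absNorm P.1 :=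
  one_lt_pow₀ (one_lt_card_cast F) P.2.2.natDegree_pos.ne'

theorem multipliable_localFactor : Multipliable fun P : MonicPrime F => localFactor P.1 := by
  have h : Summable fun P : MonicPrime F =>
      (-(absNorm P.1)⁻¹ ^ 2 - (absNorm P.1)⁻¹ ^ 3 + (absNorm P.1)⁻¹ ^ 4) := by
    refine Summable.of_norm_bounded ((summable_absNorm_inv_sq (F := F)).mul_left 3) fun P => ?_
    have h1 := one_lt_absNorm P
    have h2 : (absNorm P.1)⁻¹ ≤ 1 := (inv_lt_one_of_one_lt₀ h1).le
    have h3 : 0 ≤ (absNorm P.1)⁻¹ := by positivity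
    set x := (absNorm P.1)⁻¹
    have h4 : x ^ 3 ≤ x ^ 2 := pow_le_pow_of_le_one h3 h2 (by norm_num)
    have h5 : x ^ 4 ≤ x ^ 2 := pow_le_pow_of_le_one h3 h2 (by norm_num)
    have h6 : 0 ≤ x ^ 4 := by positivity
    have h7 : 0 ≤ x ^ 3 := by positivity
    rw [Real.norm_eq_abs, abs_le]
    constructor <;> linarith
  have := Real.multipliable_one_add_of_summable h
  refine this.congr fun P => ?_
  rw [localFactor]; ring

theorem multipliable_one_sub_inv_sq :
    Multipliable fun P : MonicPrime F => (1 - (absNorm P.1)⁻¹ ^ 2) := by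
  have := Real.multipliable_one_add_of_summable (summable_absNorm_inv_sq (F := F)).neg
  exact this.congr fun P => by ring

theorem tprod_one_sub_inv_sq_ne_zero :
    ∏' P : MonicPrime F, (1 - (absNorm P.1)⁻¹ ^ 2) ≠ 0 := by
  have := tprod_one_add_ne_zero_of_summable (f := fun P : MonicPrime F => -(absNorm P.1)⁻¹ ^ 2)
    (fun P => ?_) ?_
  · simpa [sub_eq_add_neg] using this
  · have h1 := one_lt_absNorm P
    have h2 : (absNorm P.1)⁻¹ ^ 2 < 1 :=
      pow_lt_one₀ (by positivity) (inv_lt_one_of_one_lt₀ h1) two_ne_zero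
    have : 0 < 1 + -(absNorm P.1)⁻¹ ^ 2 := by linarith
    exact this.ne'
  · exact (summable_absNorm_inv_sq (F := F)).neg.norm

theorem multipliable_eulerFactor : Multipliable fun P : MonicPrime F =>
    (1 - 1 / ((absNorm P.1 + 1) * absNorm P.1 ^ 2)) := by
  have h : Summable fun P : MonicPrime F => -(1 / ((absNorm P.1 + 1) * absNorm P.1 ^ 2)) := by
    refine Summable.of_norm_bounded (summable_absNorm_inv_sq (F := F)) fun P => ?_
    have h1 := one_lt_absNorm P
    rw [norm_neg, Real.norm_of_nonneg (by positivity), inv_pow, one_div]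
    exact inv_anti₀ (by positivity) (by nlinarith [sq_nonneg (absNorm P.1)])
  exact (Real.multipliable_one_add_of_summable h).congr fun P => by ring

theorem eulerFactor_pos (P : MonicPrime F) :
    0 < 1 - 1 / ((absNorm P.1 + 1) * absNorm P.1 ^ 2) := by
  have h1 := one_lt_absNorm P
  rw [sub_pos, div_lt_one (by positivity)]
  nlinarith [sq_nonneg (absNorm P.1 - 1)]

theorem tprod_eulerFactor_ne_zero :
    ∏' P : MonicPrime F, (1 - 1 / ((absNorm P.1 + 1) * absNorm P.1 ^ 2)) ≠ 0 := by
  have := tprod_one_add_ne_zero_of_summable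
    (f := fun P : MonicPrime F => -(1 / ((absNorm P.1 + 1) * absNorm P.1 ^ 2)))
    (fun P => ?_) ?_
  · simpa only [sub_eq_add_neg] using this
  · have := eulerFactor_pos P
    rw [sub_eq_add_neg] at this
    exact this.ne'
  · refine Summable.of_norm_bounded (summable_absNorm_inv_sq (F := F)) fun P => ?_
    have h1 := one_lt_absNorm P
    rw [norm_norm, norm_neg, Real.norm_of_nonneg (by positivity), inv_pow, one_div]
    exact inv_anti₀ (by positivity) (by nlinarith [sq_nonneg (absNorm P.1)])

theorem tprod_localFactor : ∏' P : MonicPrime F, localFactor P.1 =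
    (∏' P : MonicPrime F, (1 - (absNorm P.1)⁻¹ ^ 2)) *
      ∏' P : MonicPrime F, (1 - 1 / ((absNorm P.1 + 1) * absNorm P.1 ^ 2)) := by
  rw [← multipliable_one_sub_inv_sq.tprod_mul multipliable_eulerFactor]
  refine tprod_congr fun P => ?_
  have h1 := one_lt_absNorm P
  have h2 : absNorm P.1 + 1 ≠ 0 := by linarith
  have h3 : absNorm P.1 ≠ 0 := by linarith
  rw [localFactor]
  field_simp
  ring

end Limits

section MeanValue

variable {F : Type} [Field F] [Fintype F]

variable (F) in
/-- The triples `(a, b, c)` for which `b² + ac` is square-free. -/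
noncomputable def squarefreeTriples (n m : ℕ) : Finset (F[X] × F[X] × F[X]) :=
  (triples F n m).filter fun t => Squarefree (t.2.1 ^ 2 + t.1 * t.2.2)

theorem card_reducedPairs_eq {D : F[X]} {g : ℕ} :
    Nat.card (reducedPairs D g) = ∑ n ∈ Finset.range (g + 1),
      ((Mn F n ×ˢ polysLT F n).filter fun p => p.1 ∣ p.2 ^ 2 - D).card := by
  have h : reducedPairs D g = ((Finset.range (g + 1)).biUnion fun n =>
      (Mn F n ×ˢ polysLT F n).filter fun p => p.1 ∣ p.2 ^ 2 - D : Finset (F[X] × F[X])) := by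
    ext ⟨a, b⟩
    simp only [reducedPairs, Set.mem_ofPred_eq, Finset.coe_biUnion, Finset.mem_coe,
      Finset.mem_range, Set.mem_iUnion, Finset.mem_filter, Finset.mem_product, mem_Mn,
      mem_polysLT, exists_prop]
    constructor
    · rintro ⟨h1, h2, h3, h4⟩
      rw [degree_eq_natDegree h1.ne_zero] at h3
      exact ⟨a.natDegree, by omega, ⟨⟨h1, rfl⟩, h3⟩, h4⟩
    · rintro ⟨_, h1, ⟨⟨h2, rfl⟩, h3⟩, h4⟩
      rw [← degree_eq_natDegree h2.ne_zero] at h3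
      exact ⟨h2, by omega, h3, h4⟩
  rw [h, Nat.card_eq_card_toFinset, Finset.toFinset_coe, Finset.card_biUnion]
  intro n _ n' _ hne
  rw [Function.onFun, Finset.disjoint_left]
  rintro ⟨a, b⟩ h1 h2
  simp only [Finset.mem_filter, Finset.mem_product, mem_Mn] at h1 h2
  exact hne (h1.1.1.2.symm.trans h2.1.1.2)

theorem sum_card_pairs_eq {g n : ℕ} (hn : n ≤ g) :
    ∑ D ∈ (Mn F (2 * g + 1)).filter (fun D => Squarefree D),
      ((Mn F n ×ˢ polysLT F n).filter fun p => p.1 ∣ p.2 ^ 2 - D).card =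
      (squarefreeTriples F n (2 * g + 1 - n)).card := by
  rw [← Finset.card_sigma]
  refine (Finset.card_bij (fun t _ => ⟨t.2.1 ^ 2 + t.1 * t.2.2, (t.1, t.2.1)⟩) ?_ ?_ ?_).symm
  · intro t ht
    obtain ⟨ht, hsf⟩ := Finset.mem_filter.1 ht
    have h1 := natDegree_sq_add_mul (by omega : n ≤ 2 * g + 1 - n) ht
    rw [Nat.add_sub_cancel' (by omega)] at h1
    simp only [triples, Finset.mem_product] at ht
    simp only [Finset.mem_sigma, Finset.mem_filter, Finset.mem_product]
    exact ⟨⟨h1, hsf⟩, ⟨ht.1, ht.2.1⟩, -t.2.2, by ring⟩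
  · rintro ⟨a, b, c⟩ ht ⟨a', b', c'⟩ ht' h
    simp only [squarefreeTriples, triples, Finset.mem_filter, Finset.mem_product, mem_Mn] at ht
    simp only [Sigma.mk.injEq, heq_eq_eq, Prod.mk.injEq] at h
    obtain ⟨h1, rfl, rfl⟩ := h
    rw [add_right_inj] at h1
    rw [mul_left_cancel₀ ht.1.1.1.ne_zero h1]
  · rintro ⟨D, a, b⟩ h
    simp only [Finset.mem_sigma, Finset.mem_filter, Finset.mem_product, mem_Mn,
      mem_polysLT] at h
    obtain ⟨⟨⟨hD, hdeg⟩, hsf⟩, ⟨⟨ha, rfl⟩, hb⟩, e, he⟩ := h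
    have hDe : b ^ 2 + a * -e = D := by linear_combination he
    have hbD : (b ^ 2).degree < D.degree := by
      rw [degree_eq_natDegree hD.ne_zero, hdeg]
      by_cases hb0 : b = 0
      · simp only [hb0, ne_eq, OfNat.ofNat_ne_zero, not_false_eq_true, zero_pow, degree_zero]
        exact WithBot.bot_lt_coe _
      · rw [degree_eq_natDegree hb0] at hb
        rw [degree_eq_natDegree (pow_ne_zero 2 hb0), natDegree_pow]
        norm_cast at hb ⊢
        omega
    have hac : a * -e = D - b ^ 2 := by linear_combination he
    have hm : (a * -e).Monic := by
      rw [hac]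
      exact hD.sub_of_left hbD
    have he' : (-e).Monic := ha.of_mul_monic_left hm
    have hd : a.natDegree + (-e).natDegree = 2 * g + 1 := by
      rw [← ha.natDegree_mul he', hac,
        natDegree_eq_of_degree_eq (degree_sub_eq_left_of_degree_lt hbD), hdeg]
    refine ⟨(a, b, -e), ?_, by simp only [hDe]⟩
    simp only [squarefreeTriples, triples, Finset.mem_filter, Finset.mem_product, mem_Mn,
      mem_polysLT]
    exact ⟨⟨⟨ha, trivial⟩, hb, he', by omega⟩, by rwa [hDe]⟩

theorem sum_classNumber_eq (h2 : (2 : F) ≠ 0) (g : ℕ) :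
    ∑ D ∈ (Mn F (2 * g + 1)).filter (fun D => Squarefree D), classNumber D =
      ∑ n ∈ Finset.range (g + 1), (squarefreeTriples F n (2 * g + 1 - n)).card := by
  have : ∀ D ∈ (Mn F (2 * g + 1)).filter (fun D => Squarefree D), classNumber D =
      ∑ n ∈ Finset.range (g + 1),
        ((Mn F n ×ˢ polysLT F n).filter fun p => p.1 ∣ p.2 ^ 2 - D).card := by
    intro D hD
    obtain ⟨hD, hsf⟩ := Finset.mem_filter.1 hD
    rw [← card_reducedPairs_eq, classNumber_eq_card_reducedPairs h2 hsf (mem_Mn.1 hD).2]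
  rw [Finset.sum_congr rfl this, Finset.sum_comm]
  exact Finset.sum_congr rfl fun n hn =>
    sum_card_pairs_eq (Nat.lt_succ_iff.1 (Finset.mem_range.1 hn))

theorem tendsto_nat_mul_sqrt {q : ℝ} (hq : 4 < q) :
    Filter.Tendsto (fun g : ℕ => (g : ℝ) * Real.sqrt (2 * (4 / q) ^ g)) Filter.atTop (nhds 0) := by
  have h0 : 0 ≤ 4 / q := by positivity
  have h1 : Real.sqrt (4 / q) < 1 := by
    rw [Real.sqrt_lt' one_pos, div_lt_iff₀ (by linarith)]
    linarith
  have := (tendsto_self_mul_const_pow_of_lt_one (Real.sqrt_nonneg (4 / q)) h1).const_mul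
    (Real.sqrt 2)
  rw [mul_zero] at this
  refine this.congr fun g => ?_
  rw [Real.sqrt_mul (by norm_num), Real.sqrt_eq_rpow ((4 / q) ^ g), Real.sqrt_eq_rpow (4 / q),
    ← Real.rpow_natCast, ← Real.rpow_natCast, ← Real.rpow_mul h0, ← Real.rpow_mul h0,
    mul_comm (1 / 2 : ℝ)]
  ring

theorem le_add_sqrt_mul {r a x y : ℝ} (hx : 0 ≤ x) (hy : 0 ≤ y) (ha : 0 ≤ a)
    (h1 : r ≤ a + x) (h2 : r ≤ y) : r ≤ a + Real.sqrt (x * y) := by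
  rcases le_total x y with h | h
  · have : x ≤ Real.sqrt (x * y) := Real.le_sqrt_of_sq_le (by nlinarith)
    linarith
  · have : y ≤ Real.sqrt (x * y) := Real.le_sqrt_of_sq_le (by nlinarith)
    linarith

theorem tendsto_prod_smallPrimes {f : MonicPrime F → ℝ} (hf : Multipliable f) :
    Filter.Tendsto (fun K => ∏ P ∈ smallPrimes F K, f P) Filter.atTop (nhds (∏' P, f P)) :=
  hf.hasProd.comp tendsto_smallPrimes

/-- The density of square-free values among the triples with `a` of degree `g - j`. -/
theorem tendsto_squarefreeTriples (hq : 4 < Fintype.card F) (j : ℕ) :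
    Filter.Tendsto (fun g : ℕ => ((squarefreeTriples F (g - j) (2 * g + 1 - (g - j))).card : ℝ) /
      (Fintype.card F : ℝ) ^ ((g - j) + (2 * g + 1))) Filter.atTop
      (nhds (∏' P : MonicPrime F, localFactor P.1)) := by
  have hq' : (4 : ℝ) < Fintype.card F := by exact_mod_cast hq
  have hq0 : (0 : ℝ) < Fintype.card F := by linarith
  have hq1 := one_lt_card_cast F
  have hexp : ∀ g, (g - j) + (g - j) + (2 * g + 1 - (g - j)) = (g - j) + (2 * g + 1) := by omega
  refine tendsto_of_sieve (r := (Fintype.card F : ℝ)⁻¹)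
    (η := fun g => Real.sqrt (2 * (4 / (Fintype.card F : ℝ)) ^ g))
    (u := fun K g => (((triples F (g - j) (2 * g + 1 - (g - j))).filter
      (fun t => ∀ P ∈ smallPrimes F K, ¬ P.1 ^ 2 ∣ t.2.1 ^ 2 + t.1 * t.2.2)).card : ℝ) /
      (Fintype.card F : ℝ) ^ ((g - j) + (2 * g + 1)))
    (by positivity) (inv_lt_one_of_one_lt₀ hq1) ?_ ?_ ?_ (fun g => Real.sqrt_nonneg _)
    (tendsto_nat_mul_sqrt hq') (tendsto_prod_smallPrimes multipliable_localFactor)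
  · intro K g
    refine div_le_div_of_nonneg_right (Nat.cast_le.2 ?_) (by positivity)
    exact card_filter_squarefree_le _ (fun t : F[X] × F[X] × F[X] => t.2.1 ^ 2 + t.1 * t.2.2)
      (fun t ht => natDegree_sq_add_mul (by omega) ht) _
  · refine fun K => Filter.Eventually.of_forall fun g => ?_
    have h := card_filter_sieve_le (triples F (g - j) (2 * g + 1 - (g - j)))
      (fun t : F[X] × F[X] × F[X] => t.2.1 ^ 2 + t.1 * t.2.2) (g := g)
      (fun t ht => by
        have := natDegree_sq_add_mul (by omega) ht
        rwa [Nat.add_sub_cancel' (by omega)] at this) K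
    rw [div_le_iff₀ (by positivity), add_mul, div_mul_cancel₀ _ (by positivity)]
    refine (Nat.cast_le.2 h).trans ?_
    push_cast
    refine add_le_add le_rfl ?_
    rw [Finset.sum_mul]
    refine Finset.sum_le_sum fun k hk => ?_
    rw [Finset.mem_Ico] at hk
    have b1 := card_badTriples_le_add (F := F) (g - j) (2 * g + 1 - (g - j)) k
    have b2 := card_badTriples_le_mul (F := F) (n := g - j) (m := 2 * g + 1 - (g - j)) (k := k)
      (by omega) (by omega)
    rw [Nat.add_sub_cancel' (by omega)] at b2
    rw [hexp, ← div_le_iff₀ (by positivity)] at b1 b2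
    rw [← div_le_iff₀ (by positivity)]
    refine (le_add_sqrt_mul (by positivity) (by positivity) (by positivity) b1 b2).trans ?_
    refine add_le_add (by rw [inv_pow]) (Real.sqrt_le_sqrt ?_)
    have hpow : (Fintype.card F : ℝ) ^ g ≤ (Fintype.card F : ℝ) ^ (2 * g + 1 - (g - j)) :=
      pow_le_pow_right₀ hq1.le (by omega)
    calc _ = 2 * 4 ^ g * ((Fintype.card F : ℝ) ^ (2 * g + 1 - (g - j)))⁻¹ := by
          rw [pow_succ, pow_mul]
          field_simp
          norm_num
      _ ≤ 2 * 4 ^ g * ((Fintype.card F : ℝ) ^ g)⁻¹ := by gcongr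
      _ = _ := by rw [div_pow]; field_simp
  · intro K
    filter_upwards [Filter.eventually_ge_atTop
      (j + (∏ P ∈ smallPrimes F K, P.1 ^ 2).natDegree)] with g hg
    rw [card_triples_sieve _ (by omega) (by omega), hexp, mul_div_cancel_right₀ _ (by positivity)]

/-- The density of square-free polynomials of odd degree. -/
theorem tendsto_card_squarefree :
    Filter.Tendsto (fun g : ℕ => (((Mn F (2 * g + 1)).filter (fun D => Squarefree D)).card : ℝ) /
      (Fintype.card F : ℝ) ^ (2 * g + 1)) Filter.atTop
      (nhds (∏' P : MonicPrime F, (1 - (absNorm P.1)⁻¹ ^ 2))) := by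
  have hq1 := one_lt_card_cast F
  have hq0 : (0 : ℝ) < Fintype.card F := by linarith
  refine tendsto_of_sieve (r := (Fintype.card F : ℝ)⁻¹) (η := fun g => 0)
    (u := fun K g => (((Mn F (2 * g + 1)).filter
      (fun D => ∀ P ∈ smallPrimes F K, ¬ P.1 ^ 2 ∣ D)).card : ℝ) /
      (Fintype.card F : ℝ) ^ (2 * g + 1))
    (by positivity) (inv_lt_one_of_one_lt₀ hq1) ?_ ?_ ?_ (fun g => le_rfl)
    (by simp) (tendsto_prod_smallPrimes multipliable_one_sub_inv_sq)
  · intro K g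
    refine div_le_div_of_nonneg_right (Nat.cast_le.2 ?_) (by positivity)
    exact card_filter_squarefree_le _ (fun D => D) (fun D hD => hD) _
  · refine fun K => Filter.Eventually.of_forall fun g => ?_
    have h := card_filter_sieve_le (Mn F (2 * g + 1)) (fun D => D) (fun D hD => hD) K
    rw [div_le_iff₀ (by positivity), add_mul, div_mul_cancel₀ _ (by positivity)]
    refine (Nat.cast_le.2 h).trans ?_
    push_cast
    refine add_le_add le_rfl ?_
    rw [Finset.sum_mul]
    refine Finset.sum_le_sum fun k hk => ?_
    rw [Finset.mem_Ico] at hk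
    refine (card_Mn_bad_le (by omega)).trans ?_
    refine mul_le_mul_of_nonneg_right ?_ (by positivity)
    rw [inv_pow, add_zero]
    have : 0 ≤ ((Fintype.card F : ℝ) ^ k)⁻¹ := by positivity
    linarith
  · intro K
    filter_upwards [Filter.eventually_ge_atTop
      (∏ P ∈ smallPrimes F K, P.1 ^ 2).natDegree] with g hg
    rw [card_Mn_sieve _ (by omega), mul_div_cancel_right₀ _ (by positivity)]

theorem tendsto_sum_classNumber (hq : 4 < Fintype.card F) (h2 : (2 : F) ≠ 0) :
    Filter.Tendsto (fun g : ℕ =>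
      (∑ D ∈ (Mn F (2 * g + 1)).filter (fun D => Squarefree D), (classNumber D : ℝ)) /
        (Fintype.card F : ℝ) ^ (g + (2 * g + 1))) Filter.atTop
      (nhds ((1 - 1 / (Fintype.card F : ℝ))⁻¹ * ∏' P : MonicPrime F, localFactor P.1)) := by
  have hq1 := one_lt_card_cast F
  have hq0 : (0 : ℝ) < Fintype.card F := by linarith
  set q : ℝ := (Fintype.card F : ℝ) with hqdef
  set t : ℕ → ℕ → ℝ := fun g j => ((squarefreeTriples F (g - j) (2 * g + 1 - (g - j))).card : ℝ) /
      q ^ ((g - j) + (2 * g + 1)) with ht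
  have hr1 : q⁻¹ < 1 := inv_lt_one_of_one_lt₀ hq1
  have hr0 : 0 ≤ q⁻¹ := by positivity
  have key : ∀ g : ℕ, (∑ D ∈ (Mn F (2 * g + 1)).filter (fun D => Squarefree D),
      (classNumber D : ℝ)) / q ^ (g + (2 * g + 1)) =
      ∑' j, (if j ≤ g then q⁻¹ ^ j * t g j else 0) := by
    intro g
    rw [tsum_eq_sum (s := Finset.range (g + 1)) (fun j hj => by
      rw [if_neg]; simpa [Nat.lt_succ_iff] using hj)]
    rw [← Nat.cast_sum, sum_classNumber_eq h2, Nat.cast_sum,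
      ← Finset.sum_range_reflect, Finset.sum_div]
    refine Finset.sum_congr rfl fun j hj => ?_
    have hj' : j ≤ g := Nat.lt_succ_iff.1 (Finset.mem_range.1 hj)
    rw [if_pos hj', show g + 1 - 1 - j = g - j by omega, ht]
    simp only
    obtain ⟨l, rfl⟩ := Nat.exists_eq_add_of_le hj'
    rw [Nat.add_sub_cancel_left, add_assoc j l, pow_add q j, inv_pow]
    field_simp
  have ht1 : ∀ g j, t g j ≤ 1 := by
    intro g j
    rw [ht]
    simp only
    rw [div_le_one (by positivity)]
    have h1 : (squarefreeTriples F (g - j) (2 * g + 1 - (g - j))).card ≤ _ :=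
      (Finset.card_filter_le _ _).trans (card_triples _ _).le
    rw [show (g - j) + (g - j) + (2 * g + 1 - (g - j)) = (g - j) + (2 * g + 1) by omega] at h1
    rw [hqdef]
    exact_mod_cast h1
  have ht0 : ∀ g j, 0 ≤ t g j := fun g j => by positivity
  simp only [key]
  have hlim : (1 - 1 / q)⁻¹ * ∏' P : MonicPrime F, localFactor P.1 =
      ∑' j : ℕ, q⁻¹ ^ j * ∏' P : MonicPrime F, localFactor P.1 := by
    rw [tsum_mul_right, tsum_geometric_of_lt_one hr0 hr1, one_div]
  rw [hlim]
  refine tendsto_tsum_of_dominated_convergence (bound := fun j => q⁻¹ ^ j)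
    (summable_geometric_of_lt_one hr0 hr1) ?_ ?_
  · intro j
    refine ((tendsto_squarefreeTriples hq j).const_mul (q⁻¹ ^ j)).congr' ?_
    filter_upwards [Filter.eventually_ge_atTop j] with g hg
    rw [if_pos hg]
  · refine Filter.Eventually.of_forall fun g j => ?_
    split_ifs
    · rw [Real.norm_of_nonneg (mul_nonneg (by positivity) (ht0 g j))]
      exact mul_le_of_le_one_right (by positivity) (ht1 g j)
    · rw [norm_zero]; positivity

theorem two_ne_zero_of_odd_card (h : Fintype.card F % 2 = 1) : (2 : F) ≠ 0 :=
  Ring.two_ne_zero fun hF => by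
    have := FiniteField.even_card_of_char_two hF
    omega

end MeanValue

/-- For fixed `𝔽_q` with `q ≡ 1 (mod 4)`, as `g → ∞` the average class number
`(1/#H_{2g+1,q}) ∑_{D ∈ H_{2g+1,q}} h_D` is asymptotic to
`(√|D|/√q) ζ_A(2) P(2)` with `|D| = q^{2g+1}`, `ζ_A(2) = 1/(1-q⁻¹)` and
`P(2) = ∏_{P monic irreducible} (1 - 1/((|P|+1)|P|²))`; i.e. the ratio tends to `1`. -/
theorem mean_class_number (F : Type) [Field F] [Fintype F]
    (h4 : Fintype.card F % 4 = 1) :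
    Filter.Tendsto
      (fun g : ℕ =>
        ((∑ D ∈ (Mn F (2 * g + 1)).filter (fun D => Squarefree D), (classNumber D : ℝ))
            / (((Mn F (2 * g + 1)).filter (fun D => Squarefree D)).card : ℝ))
          / (Real.sqrt ((Fintype.card F : ℝ) ^ (2 * g + 1)) / Real.sqrt (Fintype.card F) *
              (1 - 1 / (Fintype.card F : ℝ))⁻¹ *
                ∏' P : {P : Polynomial F // P.Monic ∧ Irreducible P},
                  (1 - 1 / (((Fintype.card F : ℝ) ^ P.1.natDegree + 1) *
                    ((Fintype.card F : ℝ) ^ P.1.natDegree) ^ 2))))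
      Filter.atTop (nhds 1) := by
  have hcard : 1 < Fintype.card F := Fintype.one_lt_card
  have hq : 4 < Fintype.card F := by omega
  have hq0 : (0 : ℝ) < Fintype.card F := by positivity
  have hT := tendsto_sum_classNumber hq (two_ne_zero_of_odd_card (by omega))
  have hS := tendsto_card_squarefree (F := F)
  have hW := tprod_one_sub_inv_sq_ne_zero (F := F)
  have hP : ∏' P : {P : Polynomial F // P.Monic ∧ Irreducible P},
      (1 - 1 / (((Fintype.card F : ℝ) ^ P.1.natDegree + 1) *
        ((Fintype.card F : ℝ) ^ P.1.natDegree) ^ 2)) ≠ 0 := tprod_eulerFactor_ne_zero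
  have hV : ∏' P : MonicPrime F, localFactor P.1 = (∏' P : MonicPrime F, (1 - (absNorm P.1)⁻¹ ^ 2)) *
      ∏' P : {P : Polynomial F // P.Monic ∧ Irreducible P},
      (1 - 1 / (((Fintype.card F : ℝ) ^ P.1.natDegree + 1) *
        ((Fintype.card F : ℝ) ^ P.1.natDegree) ^ 2)) := tprod_localFactor
  rw [hV] at hT
  set W := ∏' P : MonicPrime F, (1 - (absNorm P.1)⁻¹ ^ 2)
  set E := ∏' P : {P : Polynomial F // P.Monic ∧ Irreducible P},
      (1 - 1 / (((Fintype.card F : ℝ) ^ P.1.natDegree + 1) *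
        ((Fintype.card F : ℝ) ^ P.1.natDegree) ^ 2))
  have hZ : (1 - 1 / (Fintype.card F : ℝ))⁻¹ ≠ 0 := by
    have := one_lt_card_cast F
    refine inv_ne_zero (sub_ne_zero.2 fun h => ?_)
    rw [eq_div_iff hq0.ne'] at h
    linarith
  have hlim := (hT.div hS hW).div_const ((1 - 1 / (Fintype.card F : ℝ))⁻¹ * E)
  have h1 : (1 - 1 / (Fintype.card F : ℝ))⁻¹ * (W * E) / W /
      ((1 - 1 / (Fintype.card F : ℝ))⁻¹ * E) = 1 := by
    generalize (1 - 1 / (Fintype.card F : ℝ))⁻¹ = Z at hZ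
    field_simp
  rw [h1] at hlim
  refine hlim.congr fun g => ?_
  have hsqrt : Real.sqrt ((Fintype.card F : ℝ) ^ (2 * g + 1)) / Real.sqrt (Fintype.card F) =
      (Fintype.card F : ℝ) ^ g := by
    rw [pow_succ, Real.sqrt_mul (by positivity), mul_comm 2 g, pow_mul,
      Real.sqrt_sq (by positivity), mul_div_cancel_right₀ _ (Real.sqrt_pos.2 hq0).ne']
  rw [hsqrt, Pi.div_apply, pow_add _ g]
  have hc : (Fintype.card F : ℝ) ^ (2 * g + 1) ≠ 0 := by positivity
  rw [← div_div _ ((Fintype.card F : ℝ) ^ g), div_div_div_cancel_right₀ hc, mul_assoc]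
  simp only [div_eq_mul_inv, mul_inv]
  ring
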